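/- arXiv:1901.08858 — 13 statements merged into one kernel-verified Lean document; each statement's English description precedes it below -/
import Mathlib

section
/- Let d, k, n be integers with 0 < k < n and 1 < d ≤ n, let q be a prime power, and write n = q·s + r with 0 ≤ r < q. Let K = {σ ∈ S_n : σ(i) ≡ i (mod q) for every i ∈ {1,…,n}}. Suppose there exists a k-dimensional subspace C of F_q^n whose minimum Hamming distance is at least d and whose dual code C⊥ contains a codeword of Hamming weight n. Then for every finite subset Γ' ⊆ K whose distinct elements have pairwise Hamming distance at least d, there exists a subset Γ ⊆ S_n whose distinct elements have pairwise Hamming distance at least d and such that |Γ| ≥ n!·|Γ'| / ((s+1)!^r · s!^{q−r} · q^{n−k−1}). -/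
open Nat

/-- Hamming distance between two permutations: the number of points where they differ. -/
def permDist {m : ℕ} (σ τ : Equiv.Perm (Fin m)) : ℕ :=
  hammingDist (σ : Fin m → Fin m) (τ : Fin m → Fin m)

/-- The dual code of a linear code `C ⊆ F^n`. -/
def dualCode {F : Type*} [Field F] {m : ℕ} (C : Submodule F (Fin m → F)) :
    Set (Fin m → F) :=
  {u | ∀ c ∈ C, ∑ i, u i * c i = 0}

lemma pc_residue_card (q s r n : ℕ) (hn : n = q * s + r) (hr : r < q) (i : Fin q) :
    Fintype.card {a : Fin n // (a : ℕ) % q = i} = if (i : ℕ) < r then s + 1 else s := by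
  have hq : 0 < q := by omega
  have h := Nat.count_modEq_card n hq (i : ℕ)
  have h1 : n % q = r := by
    rw [hn, Nat.mul_add_mod, Nat.mod_eq_of_lt hr]
  have h2 : n / q = s := by
    rw [hn, Nat.mul_add_div hq, Nat.div_eq_of_lt hr, add_zero]
  rw [h1, h2, Nat.mod_eq_of_lt i.2, Nat.count_eq_card_filter_range] at h
  have h3 : Fintype.card {a : Fin n // (a : ℕ) % q = i} =
      ((Finset.range n).filter (fun x => x ≡ (i : ℕ) [MOD q])).card := by
    rw [Fintype.card_subtype]
    apply Finset.card_bij (fun (a : Fin n) _ => (a : ℕ))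
    · intro a ha
      simp only [Finset.mem_filter, Finset.mem_univ, true_and] at ha
      simp only [Finset.mem_filter, Finset.mem_range, Nat.ModEq, ha, a.2, Nat.mod_eq_of_lt i.2,
        and_self]
    · intro a _ b _ hab
      exact Fin.ext hab
    · intro b hb
      simp only [Finset.mem_filter, Finset.mem_range, Nat.ModEq, Nat.mod_eq_of_lt i.2] at hb
      exact ⟨⟨b, hb.1⟩, by simpa using hb.2, rfl⟩
  rw [h3, h]
  split_ifs <;> rfl

lemma pc_prod (q s r : ℕ) (hr : r < q) :
    ∏ i : Fin q, (if (i : ℕ) < r then s + 1 else s)! = (s + 1)! ^ r * (s !) ^ (q - r) := by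
  rw [Fin.prod_univ_eq_prod_range (fun i => (if i < r then s + 1 else s)!) q,
    ← Finset.prod_range_mul_prod_Ico _ hr.le]
  congr 1
  · rw [Finset.prod_congr rfl (g := fun _ => (s + 1)!)]
    · simp
    · intro x hx
      rw [if_pos (Finset.mem_range.mp hx)]
  · rw [Finset.prod_congr rfl (g := fun _ => s !)]
    · simp
    · intro x hx
      rw [if_neg (by have := Finset.mem_Ico.mp hx; omega)]

lemma pc_stab (q s r n : ℕ) (hn : n = q * s + r) (hr : r < q)
    (F : Type*) [Fintype F] [DecidableEq F] (ψ : Fin q ≃ F) (g : Fin n → F)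
    (hg : ∀ a i, g a = ψ i ↔ (a : ℕ) % q = i) :
    Fintype.card {σ : Equiv.Perm (Fin n) // g ∘ σ = g} = (s + 1)! ^ r * (s !) ^ (q - r) := by
  rw [DomMulAct.stabilizer_card, ← pc_prod q s r hr, ← ψ.prod_comp]
  refine Finset.prod_congr rfl fun i _ => ?_
  rw [← pc_residue_card q s r n hn hr i]
  congr 1
  exact Fintype.card_congr (Equiv.subtypeEquivRight fun a => hg a i)

lemma pc_image (n : ℕ) (F : Type*) [DecidableEq F] (g : Fin n → F) (N : ℕ)
    (hN : Fintype.card {σ : Equiv.Perm (Fin n) // g ∘ σ = g} = N) :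
    n ! ≤ N * (Finset.univ.image (fun σ : Equiv.Perm (Fin n) => g ∘ σ)).card := by
  have h := Finset.card_le_mul_card_image (f := fun σ : Equiv.Perm (Fin n) => g ∘ σ)
    (Finset.univ) N ?_
  · simpa [Fintype.card_perm] using h
  · intro v hv
    obtain ⟨τ, -, rfl⟩ := Finset.mem_image.mp hv
    rw [← hN, Fintype.card_subtype]
    apply Finset.card_le_card_of_injOn (fun σ => σ * τ⁻¹)
    · intro σ hσ
      simp only [Finset.coe_filter, Finset.mem_univ, true_and, Set.mem_ofPred_eq] at hσ ⊢
      funext a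
      have := congrFun hσ (τ⁻¹ a)
      simpa using this
    · intro a _ b _ hab
      exact mul_right_cancel hab

lemma pc_ker_card (n k : ℕ) (hkn : k < n) (F : Type*) [Field F] [Fintype F]
    (C : Submodule F (Fin n → F)) (hdim : Module.finrank F C = k)
    (ℓ : (Fin n → F) →ₗ[F] F) (hℓ : ℓ ≠ 0) (hC : C ≤ LinearMap.ker ℓ) :
    Nat.card (LinearMap.ker (C.liftQ ℓ hC)) = Fintype.card F ^ (n - k - 1) := by
  rw [Module.natCard_eq_pow_finrank (K := F), Nat.card_eq_fintype_card]
  congr 1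
  have h1 := Submodule.finrank_quotient_add_finrank C
  have h2 := (C.liftQ ℓ hC).finrank_range_add_finrank_ker
  have h3 : LinearMap.range (C.liftQ ℓ hC) = ⊤ := by
    rw [Submodule.range_liftQ, LinearMap.range_eq_top]
    exact LinearMap.surjective hℓ
  rw [h3, finrank_top, Module.finrank_self] at h2
  rw [Module.finrank_fin_fun] at h1
  omega

/-- Theorem 3.1: if an `[n,k,d]_q` code whose dual has a full-weight codeword exists,
then from any permutation code `Γ' ⊆ K` of minimum distance at least `d`, where
`K = {σ : σ(i) ≡ i mod q}`, one obtains a permutation code `Γ ⊆ S_n` of minimum distance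
at least `d` with `|Γ| ≥ n!·|Γ'| / ((s+1)!^r · s!^(q-r) · q^(n-k-1))`. -/
theorem perm_code_lower_bound_of_linear_code_with_full_weight_dual
    (q n k d s r : ℕ) (hq : IsPrimePow q) (hk : 0 < k) (hkn : k < n)
    (hd1 : 1 < d) (hdn : d ≤ n) (hn : n = q * s + r) (hr : r < q)
    (F : Type*) [Field F] [Fintype F] [DecidableEq F] (hF : Fintype.card F = q)
    (C : Submodule F (Fin n → F)) (hdim : Module.finrank F C = k)
    (hmind : ∀ u ∈ C, u ≠ 0 → d ≤ hammingNorm u)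
    (hdual : ∃ u ∈ dualCode C, hammingNorm u = n)
    (Γ' : Finset (Equiv.Perm (Fin n)))
    (hΓ'K : ∀ σ ∈ Γ', ∀ i : Fin n, ((σ i : ℕ)) % q = (i : ℕ) % q)
    (hΓ'd : ∀ σ ∈ Γ', ∀ τ ∈ Γ', σ ≠ τ → d ≤ permDist σ τ) :
    ∃ Γ : Finset (Equiv.Perm (Fin n)),
      (∀ σ ∈ Γ, ∀ τ ∈ Γ, σ ≠ τ → d ≤ permDist σ τ) ∧
      (n ! : ℝ) * Γ'.card /
          (((s + 1)! : ℝ) ^ r * (s ! : ℝ) ^ (q - r) * (q : ℝ) ^ (n - k - 1)) ≤ Γ.card := by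
  classical
  have hq0 : 0 < q := by omega
  obtain ⟨u, hu, hun⟩ := hdual
  have hu0 : ∀ i, u i ≠ 0 := by
    intro i
    have : (Finset.univ.filter (fun i => u i ≠ 0)) = Finset.univ := by
      apply Finset.eq_univ_of_card
      rw [Fintype.card_fin]
      exact hun
    have hi : i ∈ Finset.univ.filter (fun i => u i ≠ 0) := by rw [this]; simp
    simpa using hi
  let ψ : Fin q ≃ F := (Fintype.equivFinOfCardEq hF).symm
  let g : Fin n → F := fun a => ψ ⟨(a : ℕ) % q, Nat.mod_lt _ hq0⟩
  have hg : ∀ a i, g a = ψ i ↔ (a : ℕ) % q = i := by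
    intro a i
    simp only [g, ψ.apply_eq_iff_eq, Fin.ext_iff]
  have hgK : ∀ σ ∈ Γ', ∀ a, g (σ a) = g a := by
    intro σ hσ a
    rw [hg]
    exact hΓ'K σ hσ a
  have hstab := pc_stab q s r n hn hr F ψ g hg
  have himg := pc_image n F g _ hstab
  set V := Finset.univ.image (fun σ : Equiv.Perm (Fin n) => g ∘ σ) with hV
  let ℓ : (Fin n → F) →ₗ[F] F := ∑ i, u i • LinearMap.proj i
  have hℓa : ∀ v, ℓ v = ∑ i, u i * v i := by
    intro v
    simp [ℓ, LinearMap.sum_apply]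
  have hCℓ : C ≤ LinearMap.ker ℓ := by
    intro c hc
    rw [LinearMap.mem_ker, hℓa]
    exact hu c hc
  have hℓ : ℓ ≠ 0 := by
    intro h
    have h1 := hℓa (Pi.single ⟨0, by omega⟩ 1)
    rw [h] at h1
    simp [Pi.single_apply] at h1
    exact hu0 _ h1.symm
  have hker := pc_ker_card n k hkn F C hdim ℓ hℓ hCℓ
  rw [hF] at hker
  have : Finite ((Fin n → F) ⧸ C) := Quotient.finite _
  have : Fintype ((Fin n → F) ⧸ C) := Fintype.ofFinite _
  let m : (Fin n → F) → ((Fin n → F) ⧸ C) := fun v => C.mkQ (fun i => (u i)⁻¹ * (v i - g i))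
  let T : Finset ((Fin n → F) ⧸ C) := Finset.univ.filter (fun x => x ∈ LinearMap.ker (C.liftQ ℓ hCℓ))
  have hT : T.card = q ^ (n - k - 1) := by
    rw [← hker, Nat.card_eq_fintype_card, ← Fintype.card_subtype]
  have hm : ∀ v ∈ V, m v ∈ T := by
    intro v hv
    obtain ⟨τ, -, rfl⟩ := Finset.mem_image.mp hv
    simp only [T, m, Finset.mem_filter, Finset.mem_univ, true_and, LinearMap.mem_ker,
      Submodule.mkQ_apply, Submodule.liftQ_apply, hℓa, Function.comp]
    have : ∀ i, u i * ((u i)⁻¹ * (g (τ i) - g i)) = g (τ i) - g i := by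
      intro i
      rw [mul_inv_cancel_left₀ (hu0 i)]
    simp only [this, Finset.sum_sub_distrib, Equiv.sum_comp τ g, sub_self]
  have hTne : T.Nonempty := by
    rw [← Finset.card_pos, hT]
    positivity
  have hqp : (0 : ℝ) < (q : ℝ) ^ (n - k - 1) := by positivity
  obtain ⟨y, -, hy⟩ := Finset.exists_le_card_fiber_of_nsmul_le_card_of_maps_to
    (b := (V.card : ℝ) / (q : ℝ) ^ (n - k - 1)) hm hTne (by
      rw [hT, nsmul_eq_mul]
      push_cast
      rw [mul_div_cancel₀ _ hqp.ne'])
  set W := V.filter (fun v => m v = y) with hW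
  have hrep : ∀ v : Fin n → F, ∃ τ : Equiv.Perm (Fin n), v ∈ V → g ∘ τ = v := by
    intro v
    by_cases hv : v ∈ V
    · obtain ⟨τ, -, h⟩ := Finset.mem_image.mp hv
      exact ⟨τ, fun _ => h⟩
    · exact ⟨1, fun h => absurd h hv⟩
  choose rep hrep using hrep
  have hval : ∀ γ ∈ Γ', ∀ v ∈ W, ∀ i, g ((γ * rep v) i) = v i := by
    intro γ hγ v hv i
    rw [Equiv.Perm.mul_apply, hgK γ hγ]
    exact congrFun (hrep v (Finset.mem_filter.mp hv).1) i
  refine ⟨(Γ' ×ˢ W).image (fun p => p.1 * rep p.2), ?_, ?_⟩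
  · intro σ hσ τ hτ hne
    obtain ⟨⟨γ, v⟩, hp, rfl⟩ := Finset.mem_image.mp hσ
    obtain ⟨⟨γ', v'⟩, hp', rfl⟩ := Finset.mem_image.mp hτ
    obtain ⟨hγ, hv⟩ := Finset.mem_product.mp hp
    obtain ⟨hγ', hv'⟩ := Finset.mem_product.mp hp'
    simp only at hγ hv hγ' hv' hne ⊢
    by_cases hvv : v = v'
    · subst hvv
      have hγγ : γ ≠ γ' := fun h => hne (by rw [h])
      refine (hΓ'd γ hγ γ' hγ' hγγ).trans ?_
      unfold permDist hammingDist
      apply Finset.card_le_card_of_injOn (fun a => (rep v)⁻¹ a)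
      · intro a ha
        simp only [Finset.coe_filter, Finset.mem_univ, true_and, Set.mem_ofPred_eq] at ha ⊢
        simpa using ha
      · intro a _ b _ hab
        exact (rep v)⁻¹.injective hab
    · have hmm : m v = m v' :=
        (Finset.mem_filter.mp hv).2.trans (Finset.mem_filter.mp hv').2.symm
      have hc := (Submodule.Quotient.eq C).mp hmm
      refine (hmind _ hc ?_).trans ?_
      · intro h0
        apply hvv
        funext i
        have := congrFun h0 i
        simp only [Pi.sub_apply, Pi.zero_apply, ← mul_sub, sub_sub_sub_cancel_right,
          _root_.mul_eq_zero, inv_eq_zero, hu0 i, false_or, _root_.sub_eq_zero] at this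
        exact this
      · unfold permDist hammingDist hammingNorm
        apply Finset.card_le_card
        intro i hi
        simp only [Finset.mem_filter, Finset.mem_univ, true_and] at hi ⊢
        intro h
        apply hi
        have h1 := hval γ hγ v hv i
        rw [h, hval γ' hγ' v' hv' i] at h1
        simp [h1]
  · have hcard : ((Γ' ×ˢ W).image (fun p => p.1 * rep p.2)).card = Γ'.card * W.card := by
      rw [Finset.card_image_of_injOn, Finset.card_product]
      rintro ⟨γ, v⟩ hp ⟨γ', v'⟩ hp' h
      obtain ⟨hγ, hv⟩ := Finset.mem_product.mp hp
      obtain ⟨hγ', hv'⟩ := Finset.mem_product.mp hp'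
      simp only at hγ hv hγ' hv' h
      have hvv : v = v' := by
        funext i
        rw [← hval γ hγ v hv i, h, hval γ' hγ' v' hv' i]
      subst hvv
      rw [mul_right_cancel h]
    rw [hcard]
    have himg' : (n ! : ℝ) ≤ ((s + 1)! : ℝ) ^ r * (s ! : ℝ) ^ (q - r) * V.card := by
      exact_mod_cast himg
    have hP : (0 : ℝ) < ((s + 1)! : ℝ) ^ r * (s ! : ℝ) ^ (q - r) := by positivity
    have hy' : (V.card : ℝ) ≤ W.card * (q : ℝ) ^ (n - k - 1) := (div_le_iff₀ hqp).mp hy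
    rw [div_le_iff₀ (mul_pos hP hqp)]
    push_cast
    calc (n ! : ℝ) * Γ'.card
        ≤ (((s + 1)! : ℝ) ^ r * (s ! : ℝ) ^ (q - r) * (W.card * (q : ℝ) ^ (n - k - 1)))
          * Γ'.card := by
          gcongr
          exact himg'.trans (by gcongr)
      _ = _ := by ring
end

section
/- Let d, k, n be integers with 0 < k < n and 1 < d ≤ n, let q be a prime power, and write n = q·s + r with 0 ≤ r < q. Let K = {σ ∈ S_n : σ(i) ≡ i (mod q) for every i ∈ {1,…,n}}. Suppose there exists a k-dimensional subspace C of F_q^n whose minimum Hamming distance is at least d. Then for every finite subset Γ' ⊆ K whose distinct elements have pairwise Hamming distance at least d, there exists a subset Γ ⊆ S_n whose distinct elements have pairwise Hamming distance at least d and such that |Γ| ≥ n!·|Γ'| / ((s+1)!^r · s!^{q−r} · q^{n−k}). -/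
open Nat

lemma card_class_aux (q n s r : ℕ) (hn : n = q * s + r) (hr : r < q) (j : Fin q) :
    Fintype.card {a : Fin n // (⟨(a : ℕ) % q, Nat.mod_lt _ (by omega)⟩ : Fin q) = j}
      = if (j : ℕ) < r then s + 1 else s := by
  have hq : 0 < q := by omega
  have h1 := Nat.count_modEq_card n hq (j : ℕ)
  have h2 : n / q = s := by
    rw [hn, Nat.mul_add_div hq, Nat.div_eq_of_lt hr, add_zero]
  have h3 : n % q = r := by
    rw [hn, Nat.mul_add_mod, Nat.mod_eq_of_lt hr]
  rw [h2, h3, Nat.mod_eq_of_lt j.2, Nat.count_eq_card_filter_range] at h1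
  have h4 : Fintype.card {a : Fin n // (⟨(a : ℕ) % q, Nat.mod_lt _ (by omega)⟩ : Fin q) = j}
      = ((Finset.range n).filter (fun x => x ≡ (j : ℕ) [MOD q])).card := by
    rw [Fintype.card_subtype]
    refine Finset.card_bij (fun a _ => (a : ℕ)) ?_ ?_ ?_
    · intro a ha
      simp only [Finset.mem_filter, Finset.mem_univ, true_and, Fin.ext_iff] at ha
      simp [Nat.ModEq, ha, Nat.mod_eq_of_lt j.2]
    · intro a _ b _ h
      exact Fin.ext h
    · intro b hb
      simp only [Finset.mem_filter, Finset.mem_range, Nat.ModEq, Nat.mod_eq_of_lt j.2] at hb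
      exact ⟨⟨b, hb.1⟩, by simp [Fin.ext_iff, hb.2], rfl⟩
  rw [h4, h1]
  split_ifs <;> rfl

lemma card_stab_aux (q n s r : ℕ) (hn : n = q * s + r) (hr : r < q) :
    Fintype.card {g : Equiv.Perm (Fin n) //
      (fun a : Fin n => (⟨(a : ℕ) % q, Nat.mod_lt _ (by omega)⟩ : Fin q)) ∘ g
        = (fun a : Fin n => (⟨(a : ℕ) % q, Nat.mod_lt _ (by omega)⟩ : Fin q))}
      = (s + 1)! ^ r * s ! ^ (q - r) := by
  rw [DomMulAct.stabilizer_card]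
  simp_rw [card_class_aux q n s r hn hr]
  rw [Fin.prod_univ_eq_prod_range (fun j => (if j < r then s + 1 else s)!) q,
    ← Finset.prod_range_mul_prod_Ico _ hr.le]
  congr 1
  · rw [Finset.prod_congr rfl (g := fun _ => (s + 1)!)]
    · simp
    · intro x hx
      simp [Finset.mem_range.1 hx]
  · rw [Finset.prod_congr rfl (g := fun _ => s !)]
    · simp
    · intro x hx
      have h := (Finset.mem_Ico.1 hx).1
      simp [Nat.not_lt.2 h]


/-- Theorem 3.2: if an `[n,k,d]_q` code exists, then from any permutation code
`Γ' ⊆ K = {σ : σ(i) ≡ i mod q}` of minimum distance at least `d`, one obtains a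
permutation code `Γ ⊆ S_n` of minimum distance at least `d` with
`|Γ| ≥ n!·|Γ'| / ((s+1)!^r · s!^(q-r) · q^(n-k))`. -/
theorem perm_code_lower_bound_of_linear_code
    (q n k d s r : ℕ) (hq : IsPrimePow q) (hk : 0 < k) (hkn : k < n)
    (hd1 : 1 < d) (hdn : d ≤ n) (hn : n = q * s + r) (hr : r < q)
    (F : Type*) [Field F] [Fintype F] [DecidableEq F] (hF : Fintype.card F = q)
    (C : Submodule F (Fin n → F)) (hdim : Module.finrank F C = k)
    (hmind : ∀ u ∈ C, u ≠ 0 → d ≤ hammingNorm u)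
    (Γ' : Finset (Equiv.Perm (Fin n)))
    (hΓ'K : ∀ σ ∈ Γ', ∀ i : Fin n, ((σ i : ℕ)) % q = (i : ℕ) % q)
    (hΓ'd : ∀ σ ∈ Γ', ∀ τ ∈ Γ', σ ≠ τ → d ≤ permDist σ τ) :
    ∃ Γ : Finset (Equiv.Perm (Fin n)),
      (∀ σ ∈ Γ, ∀ τ ∈ Γ, σ ≠ τ → d ≤ permDist σ τ) ∧
      (n ! : ℝ) * Γ'.card /
          (((s + 1)! : ℝ) ^ r * (s ! : ℝ) ^ (q - r) * (q : ℝ) ^ (n - k)) ≤ Γ.card := by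
  classical
  have hq0 : 0 < q := by omega
  let f : Fin n → Fin q := fun a => ⟨(a : ℕ) % q, Nat.mod_lt _ (by omega)⟩
  let e : Fin q ≃ F := (Fintype.equivFinOfCardEq hF).symm
  let c : Fin n → F := fun a => e (f a)
  let w : Equiv.Perm (Fin n) → (Fin n → F) := fun σ i => c (σ i)
  let π : Equiv.Perm (Fin n) → ((Fin n → F) ⧸ C) := fun σ => C.mkQ (w σ)
  set K : ℕ := (s + 1)! ^ r * s ! ^ (q - r) with hK
  have : Fintype ((Fin n → F) ⧸ C) := Fintype.ofFinite _
  have hcardQ : Fintype.card ((Fin n → F) ⧸ C) = q ^ (n - k) := by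
    rw [Module.card_eq_pow_finrank (K := F), hF]
    congr 1
    have := C.finrank_quotient_add_finrank
    rw [hdim, Module.finrank_fin_fun] at this
    omega
  -- pigeonhole over cosets
  obtain ⟨x, -, hx⟩ := Finset.exists_max_image (Finset.univ : Finset ((Fin n → F) ⧸ C))
    (fun b => (Finset.univ.filter (fun σ => π σ = b)).card) ⟨0, Finset.mem_univ _⟩
  set S := Finset.univ.filter (fun σ => π σ = x) with hS
  have hfact : n ! ≤ S.card * q ^ (n - k) := by
    have := Finset.card_le_mul_card_image_of_maps_to (f := π) (s := Finset.univ)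
      (t := Finset.univ) (fun _ _ => Finset.mem_univ _) S.card (fun b hb => hx b hb)
    rwa [Finset.card_univ, Finset.card_univ, hcardQ, Fintype.card_perm, Fintype.card_fin] at this
  set W := S.image w with hW
  have hSW : S.card ≤ K * W.card := by
    apply Finset.card_le_mul_card_image
    intro b hb
    obtain ⟨σ₀, hσ₀, rfl⟩ := Finset.mem_image.1 hb
    rw [hK, ← card_stab_aux q n s r hn hr, Fintype.card_subtype]
    apply Finset.card_le_card_of_injOn (fun σ => σ * σ₀⁻¹)
    · intro σ hσ
      simp only [Finset.coe_filter, Set.mem_ofPred_eq] at hσ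
      simp only [Finset.coe_filter, Set.mem_ofPred_eq, Finset.mem_univ, true_and]
      funext a
      have h := congrFun hσ.2 (σ₀⁻¹ a)
      have h' : f (σ (σ₀⁻¹ a)) = f (σ₀ (σ₀⁻¹ a)) := e.injective h
      rw [show σ₀ (σ₀⁻¹ a) = a from Equiv.apply_symm_apply σ₀ a] at h'
      exact h'
    · intro σ _ τ _ h
      exact mul_right_cancel h
  -- representatives
  have hrep : ∀ b : Fin n → F, ∃ σ : Equiv.Perm (Fin n), b ∈ W → w σ = b := by
    intro b
    by_cases hb : b ∈ W
    · obtain ⟨σ, _, h⟩ := Finset.mem_image.1 hb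
      exact ⟨σ, fun _ => h⟩
    · exact ⟨1, fun h => absurd h hb⟩
  choose ρ hρ using hrep
  have hWC : ∀ u ∈ W, ∀ v ∈ W, u - v ∈ C := by
    intro u hu v hv
    obtain ⟨σ, hσ, rfl⟩ := Finset.mem_image.1 hu
    obtain ⟨τ, hτ, rfl⟩ := Finset.mem_image.1 hv
    have h1 : π σ = x := (Finset.mem_filter.1 hσ).2
    have h2 : π τ = x := (Finset.mem_filter.1 hτ).2
    exact (Submodule.Quotient.eq C).1 (h1.trans h2.symm)
  have hwγ : ∀ γ ∈ Γ', ∀ u ∈ W, w (γ * ρ u) = u := by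
    intro γ hγ u hu
    conv_rhs => rw [← hρ u hu]
    funext i
    have : f (γ (ρ u i)) = f (ρ u i) := Fin.ext (hΓ'K γ hγ (ρ u i))
    exact congrArg e this
  have hinj : Set.InjOn (fun p : Equiv.Perm (Fin n) × (Fin n → F) => p.1 * ρ p.2)
      (Γ' ×ˢ W : Finset _) := by
    rintro ⟨γ, u⟩ h1 ⟨γ', u'⟩ h2 h
    simp only [Finset.coe_product, Set.mem_prod, Finset.mem_coe] at h1 h2
    simp only at h
    have hu : u = u' := by
      rw [← hwγ γ h1.1 u h1.2, h, hwγ γ' h2.1 u' h2.2]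
    subst hu
    rw [mul_right_cancel h]
  refine ⟨(Γ' ×ˢ W).image (fun p => p.1 * ρ p.2), ?_, ?_⟩
  · intro σ hσ τ hτ hne
    obtain ⟨⟨γ, u⟩, h1, rfl⟩ := Finset.mem_image.1 hσ
    obtain ⟨⟨γ', u'⟩, h2, rfl⟩ := Finset.mem_image.1 hτ
    rw [Finset.mem_product] at h1 h2
    simp only at h1 h2 hne ⊢
    by_cases huu : u = u'
    · subst huu
      have hγ : γ ≠ γ' := fun h => hne (by rw [h])
      refine (hΓ'd γ h1.1 γ' h2.1 hγ).trans ?_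
      unfold permDist hammingDist
      apply Finset.card_le_card_of_injOn (fun i => (ρ u)⁻¹ i)
      · intro i hi
        have hi' : γ i ≠ γ' i := by simpa using hi
        have hii : ρ u ((ρ u)⁻¹ i) = i := Equiv.apply_symm_apply (ρ u) i
        refine Finset.mem_coe.2 (Finset.mem_filter.2 ⟨Finset.mem_univ _, ?_⟩)
        change γ (ρ u ((ρ u)⁻¹ i)) ≠ γ' (ρ u ((ρ u)⁻¹ i))
        rw [hii]
        exact hi'
      · intro a _ b _ h
        exact (ρ u)⁻¹.injective h
    · have h3 := hmind (u - u') (hWC u h1.2 u' h2.2) (sub_ne_zero.2 huu)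
      refine h3.trans ?_
      unfold permDist hammingDist hammingNorm
      apply Finset.card_le_card
      intro i hi
      simp only [Finset.mem_filter, Finset.mem_univ, true_and] at hi ⊢
      intro h
      apply hi
      have e1 : w (γ * ρ u) i = u i := by rw [hwγ γ h1.1 u h1.2]
      have e2 : w (γ' * ρ u') i = u' i := by rw [hwγ γ' h2.1 u' h2.2]
      rw [Pi.sub_apply, sub_eq_zero, ← e1, ← e2]
      exact congrArg c h
  · rw [Finset.card_image_of_injOn hinj, Finset.card_product]
    have hpos : (0 : ℝ) < ((s + 1)! : ℝ) ^ r * (s ! : ℝ) ^ (q - r) * (q : ℝ) ^ (n - k) := by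
      have : (0 : ℝ) < q := by exact_mod_cast hq0
      positivity
    rw [div_le_iff₀ hpos]
    have hfin : n ! * Γ'.card ≤ Γ'.card * W.card *
        ((s + 1)! ^ r * s ! ^ (q - r) * q ^ (n - k)) := by
      rw [← hK]
      calc n ! * Γ'.card ≤ (K * W.card * q ^ (n - k)) * Γ'.card :=
            Nat.mul_le_mul_right _ (hfact.trans (Nat.mul_le_mul_right _ hSW))
        _ = _ := by ring
    exact_mod_cast hfin
end

section
/- Let q be a prime power and k an integer with 0 < k < q. If C is a [q,k]_q MDS code, i.e., a k-dimensional subspace of F_q^q whose minimum Hamming distance equals q − k + 1, then the dual code C⊥ contains a codeword of Hamming weight q, i.e., a codeword all of whose coordinates are nonzero. -/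
open Nat

/-- The minimum distance of a linear code: the minimum Hamming weight of a nonzero codeword. -/
noncomputable def minDist {F : Type*} [Field F] [DecidableEq F] {m : ℕ}
    (C : Submodule F (Fin m → F)) : ℕ :=
  sInf {w | ∃ u ∈ C, u ≠ 0 ∧ hammingNorm u = w}

/-- Nonzero codewords with small support do not exist. -/
lemma eq_zero_of_support {F : Type*} [Field F] [DecidableEq F] {q : ℕ}
    (C : Submodule F (Fin q → F)) {d : ℕ} (hd : minDist C = d) (c : Fin q → F) (hc : c ∈ C)
    (S : Finset (Fin q)) (hS : S.card < d) (h : ∀ i, i ∉ S → c i = 0) : c = 0 := by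
  by_contra hne
  have h1 : minDist C ≤ hammingNorm c := Nat.sInf_le ⟨c, hc, hne, rfl⟩
  have h2 : hammingNorm c ≤ S.card := by
    unfold hammingNorm
    apply Finset.card_le_card
    intro i hi
    by_contra hiS
    simp at hi
    exact hi (h i hiS)
  omega

/-- The dual contains a word equal to one on any given small set. -/
lemma exists_dual_one {F : Type*} [Field F] [DecidableEq F] {q : ℕ}
    (C : Submodule F (Fin q → F)) {d : ℕ} (hd : minDist C = d)
    (Z : Finset (Fin q)) (hZ : Z.card < d) :
    ∃ y ∈ dualCode C, ∀ i ∈ Z, y i = 1 := by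
  let m : C →ₗ[F] (Fin q → F) :=
    { toFun := fun c i => if i ∈ Z then 0 else c.1 i
      map_add' := by
        intro a b; ext i; by_cases h : i ∈ Z <;> simp [h]
      map_smul' := by
        intro a b; ext i; by_cases h : i ∈ Z <;> simp [h] }
  have hm : LinearMap.ker m = ⊥ := by
    rw [LinearMap.ker_eq_bot']
    intro c hc
    apply Subtype.ext
    apply eq_zero_of_support C hd c.1 c.2 Z hZ
    intro i hi
    have := congrFun hc i
    simpa [m, hi] using this
  obtain ⟨g, hg⟩ := m.exists_leftInverse_of_injective hm
  let w : Fin q → F := fun j => ∑ i ∈ Z, (g (Pi.single j 1)).1 i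
  refine ⟨fun i => if i ∈ Z then 1 else - w i, ?_, ?_⟩
  · intro c hc
    have h1 : g (m ⟨c, hc⟩) = ⟨c, hc⟩ := by
      have := LinearMap.congr_fun hg ⟨c, hc⟩
      simpa using this
    have h2 : m ⟨c, hc⟩ = ∑ j, (m ⟨c, hc⟩ j) • (Pi.single j (1 : F) : Fin q → F) :=
      pi_eq_sum_univ' _
    have h3 : c = ∑ j, (m ⟨c, hc⟩ j) • (g (Pi.single j 1)).1 := by
      have h4 := congrArg Subtype.val h1
      rw [h2] at h4
      simp only [map_sum, map_smul] at h4
      simpa using h4.symm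
    have h5 : ∑ i ∈ Z, c i = ∑ j, m ⟨c, hc⟩ j * w j := by
      conv_lhs => rw [h3]
      simp only [Finset.sum_apply, Pi.smul_apply, smul_eq_mul]
      rw [Finset.sum_comm]
      simp [w, Finset.mul_sum]
    have h6 : ∀ i, (if i ∈ Z then 1 else - w i) * c i
        = (if i ∈ Z then c i else 0) - m ⟨c, hc⟩ i * w i := by
      intro i
      by_cases h : i ∈ Z <;> simp [m, h]; ring
    simp only [h6, Finset.sum_sub_distrib, ← h5]
    simp
  · intro i hi; simp [hi]

/-- Nonzero dual words have large support. -/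
lemma dual_zero_card {F : Type*} [Field F] [DecidableEq F] {q k : ℕ} (hkq : k < q)
    (C : Submodule F (Fin q → F)) (hdim : Module.finrank F C = k)
    (hd : minDist C = q - k + 1) (x : Fin q → F) (hx : x ∈ dualCode C) (hne : x ≠ 0) :
    (Finset.univ.filter (fun i => x i = 0)).card < q - k + 1 := by
  by_contra hcon
  have hsum := Finset.card_filter_add_card_filter_not (s := (Finset.univ : Finset (Fin q)))
    (fun i => x i = 0)
  rw [Finset.card_univ, Fintype.card_fin] at hsum
  obtain ⟨T, hT, hTc⟩ := Finset.exists_superset_card_eq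
    (s := Finset.univ.filter (fun i => ¬ x i = 0)) (n := k) (by omega) (by simp; omega)
  let m : C →ₗ[F] (T → F) :=
    { toFun := fun c i => c.1 i
      map_add' := by intro a b; ext i; simp
      map_smul' := by intro a b; ext i; simp }
  have hm : Function.Injective m := by
    rw [← LinearMap.ker_eq_bot, LinearMap.ker_eq_bot']
    intro c hc
    apply Subtype.ext
    apply eq_zero_of_support C hd c.1 c.2 Tᶜ (by rw [Finset.card_compl, hTc]; simp)
    intro i hi
    exact congrFun hc ⟨i, by simpa using hi⟩
  have hs : Function.Surjective m :=
    (LinearMap.injective_iff_surjective_of_finrank_eq_finrank (by simp [hdim, hTc])).1 hm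
  obtain ⟨i, hi⟩ := Function.ne_iff.1 hne
  have hiT : i ∈ T := hT (by simpa using hi)
  obtain ⟨c, hc⟩ := hs (Pi.single ⟨i, hiT⟩ 1)
  have h0 := hx c.1 c.2
  rw [Finset.sum_eq_single i] at h0
  · have := congrFun hc ⟨i, hiT⟩
    simp [m] at this
    rw [this, mul_one] at h0
    exact hi h0
  · intro j _ hj
    by_cases hjT : j ∈ T
    · have := congrFun hc ⟨j, hjT⟩
      simp [m, hj] at this
      simp [this]
    · have : x j = 0 := by
        by_contra h
        exact hjT (hT (by simpa using h))
      simp [this]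
  · simp

/-- Corollary 4.5: the dual of a `[q,k]_q` MDS code contains a codeword of weight `q`. -/
theorem dual_of_MDS_length_q_has_full_weight_codeword
    (q k : ℕ) (hq : IsPrimePow q) (hk : 0 < k) (hkq : k < q)
    (F : Type*) [Field F] [Fintype F] [DecidableEq F] (hF : Fintype.card F = q)
    (C : Submodule F (Fin q → F)) (hdim : Module.finrank F C = k)
    (hmds : minDist C = q - k + 1) :
    ∃ u ∈ dualCode C, hammingNorm u = q := by
  suffices h : ∃ u ∈ dualCode C, ∀ i, u i ≠ 0 by
    obtain ⟨u, hu, h⟩ := h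
    exact ⟨u, hu, by simp [hammingNorm, h]⟩
  obtain ⟨x, hx, hx1⟩ := exists_dual_one C hmds {⟨0, by omega⟩} (by simp; omega)
  have hne : x ≠ 0 := by
    rintro rfl
    simpa using hx1 _ (Finset.mem_singleton_self _)
  obtain ⟨y, hy, hy1⟩ := exists_dual_one C hmds _ (dual_zero_card hkq C hdim hmds x hx hne)
  have hxy : ∀ i, x i = 0 → y i ≠ 0 := by
    intro i hi
    rw [hy1 i (by simpa using hi)]
    exact one_ne_zero
  by_cases hall : ∀ i, y i ≠ 0
  · exact ⟨y, hy, hall⟩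
  push Not at hall
  obtain ⟨i₀, hi₀⟩ := hall
  have hcard : ((Finset.univ.erase i₀).image (fun i => - x i / y i)).card < Fintype.card F := by
    refine lt_of_le_of_lt Finset.card_image_le ?_
    rw [Finset.card_erase_of_mem (Finset.mem_univ _), Finset.card_univ, Fintype.card_fin, hF]
    omega
  obtain ⟨l, hl⟩ : ∃ l, l ∉ (Finset.univ.erase i₀).image (fun i => - x i / y i) := by
    by_contra! hcon
    rw [Finset.eq_univ_of_forall hcon, Finset.card_univ] at hcard
    exact lt_irrefl _ hcard
  refine ⟨fun i => x i + l * y i, ?_, ?_⟩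
  · intro c hc
    have h1 := hx c hc
    have h2 := hy c hc
    simp only [add_mul, Finset.sum_add_distrib, h1, mul_assoc, ← Finset.mul_sum, h2]
    simp
  · intro i hi
    by_cases hyi : y i = 0
    · simp only [hyi, mul_zero, add_zero] at hi
      exact hxy i hi hyi
    · apply hl
      simp only [Finset.mem_image, Finset.mem_erase, Finset.mem_univ, and_true]
      refine ⟨i, ?_, ?_⟩
      · rintro rfl; exact hyi hi₀
      · rw [div_eq_iff hyi]
        linear_combination -hi
end

section
/- Let n be a positive integer, q a prime power with q ≥ n, and d an integer with 2 < d < n. Then there exists a subset Γ of the symmetric group S_n whose distinct elements have pairwise Hamming distance at least d and such that |Γ| ≥ n! / q^{d−2}. -/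
open Nat

theorem rs_aux {F : Type*} [Field F] {n d : ℕ} (x : Fin n → F) (hx : Function.Injective x)
    (D : Fin n → F) (h : ∀ j < d, ∑ i, D i * x i ^ j = 0)
    (S : Finset (Fin n)) (hS : ∀ i, i ∉ S → D i = 0) (hc : S.card ≤ d) : ∀ i, D i = 0 := by
  classical
  intro i0
  by_cases hi : i0 ∈ S
  swap
  · exact hS _ hi
  set P : Polynomial F := ∏ i ∈ S.erase i0, (Polynomial.X - Polynomial.C (x i)) with hP
  have hcard : (S.erase i0).card < d := by
    rw [Finset.card_erase_of_mem hi]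
    have := Finset.card_pos.2 ⟨i0, hi⟩
    omega
  have hdeg : P.natDegree < d := by
    rw [hP, Polynomial.natDegree_prod_of_monic _ _ (fun i _ => Polynomial.monic_X_sub_C _)]
    simpa using hcard
  have h0 : ∑ i, D i * P.eval (x i) = 0 := by
    simp_rw [Polynomial.eval_eq_sum_range' hdeg, Finset.mul_sum]
    rw [Finset.sum_comm]
    refine Finset.sum_eq_zero fun j hj => ?_
    have := h j (Finset.mem_range.1 hj)
    calc ∑ i, D i * (P.coeff j * x i ^ j) = P.coeff j * ∑ i, D i * x i ^ j := by
          rw [Finset.mul_sum]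
          exact Finset.sum_congr rfl fun i _ => by ring
      _ = 0 := by rw [this, mul_zero]
  rw [Finset.sum_eq_single i0] at h0
  · rcases mul_eq_zero.1 h0 with h1 | h1
    · exact h1
    · exfalso
      rw [hP, Polynomial.eval_prod, Finset.prod_eq_zero_iff] at h1
      obtain ⟨a, ha, h2⟩ := h1
      simp only [Polynomial.eval_sub, Polynomial.eval_X, Polynomial.eval_C] at h2
      exact (Finset.mem_erase.1 ha).1 (hx (sub_eq_zero.1 h2)).symm
  · intro b _ hb
    by_cases hbS : b ∈ S
    · rw [hP, Polynomial.eval_prod, Finset.prod_eq_zero (Finset.mem_erase.2 ⟨hb, hbS⟩), mul_zero]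
      simp
    · rw [hS b hbS, zero_mul]
  · simp

/-- Theorem 4.6: for every prime power `q ≥ n` and every `2 < d < n`, there is a
permutation code in `S_n` of minimum distance at least `d` and size at least `n!/q^(d-2)`. -/
theorem perm_code_lower_bound_MDS
    (n q d : ℕ) (hn : 0 < n) (hq : IsPrimePow q) (hnq : n ≤ q)
    (hd2 : 2 < d) (hdn : d < n) :
    ∃ Γ : Finset (Equiv.Perm (Fin n)),
      (∀ σ ∈ Γ, ∀ τ ∈ Γ, σ ≠ τ → d ≤ permDist σ τ) ∧
      (n ! : ℝ) / (q : ℝ) ^ (d - 2) ≤ Γ.card := by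
  classical
  obtain ⟨p, k, hp, hk, rfl⟩ := (isPrimePow_nat_iff q).1 hq
  haveI : Fact p.Prime := ⟨hp⟩
  letI : Fintype (GaloisField p k) := Fintype.ofFinite _
  have hF : Fintype.card (GaloisField p k) = p ^ k := by
    rw [← Nat.card_eq_fintype_card, GaloisField.card p k hk.ne']
  obtain ⟨x⟩ : Nonempty (Fin n ↪ GaloisField p k) :=
    Function.Embedding.nonempty_of_card_le (by simpa [hF] using hnq)
  let f : Equiv.Perm (Fin n) → (Fin (d - 2) → GaloisField p k) :=
    fun σ j => ∑ i, x (σ i) * x i ^ ((j : ℕ) + 1)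
  have hpos : (0 : ℝ) < ((p ^ k : ℕ) : ℝ) ^ (d - 2) := by
    have := hp.pos
    positivity
  obtain ⟨y, hy⟩ := Fintype.exists_le_card_fiber_of_nsmul_le_card f
    (b := (n ! : ℝ) / ((p ^ k : ℕ) : ℝ) ^ (d - 2)) (by
      rw [Fintype.card_perm, Fintype.card_fun, Fintype.card_fin, Fintype.card_fin, hF, nsmul_eq_mul,
        Nat.cast_pow (p ^ k) (d - 2), mul_div_cancel₀ _ hpos.ne'])
  refine ⟨_, ?_, hy⟩
  intro σ hσ τ hτ hne
  simp only [Finset.mem_filter, Finset.mem_univ, true_and] at hσ hτ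
  by_contra hlt
  push Not at hlt
  apply hne
  have key := rs_aux (d := d - 1) x x.injective (fun i => x (σ i) - x (τ i)) ?_
    (Finset.univ.filter fun i => σ i ≠ τ i) ?_ ?_
  · ext i
    rw [x.injective (sub_eq_zero.1 (key i))]
  · intro j hj
    simp only [sub_mul, Finset.sum_sub_distrib]
    rw [sub_eq_zero]
    rcases j with _ | j
    · simp only [pow_zero, mul_one]
      rw [Equiv.sum_comp σ (fun i => x i), Equiv.sum_comp τ (fun i => x i)]
    · exact congrFun (hσ.trans hτ.symm) ⟨j, by omega⟩
  · intro i hi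
    have : σ i = τ i := by simpa using hi
    simp [this]
  · unfold permDist hammingDist at hlt
    omega
end

section
/- Let q be a prime power and k an integer with 1 ≤ k ≤ q and k ≠ q − 1. If C is a [q+1,k]_q MDS code, i.e., a k-dimensional subspace of F_q^{q+1} whose minimum Hamming distance equals q − k + 2, then the dual code C⊥ contains a codeword of Hamming weight q + 1, i.e., a codeword all of whose coordinates are nonzero. -/
open Nat

theorem A_rec (q K : ℕ) (A : ℕ → ℤ) (hA : ∀ K, A K = ∑ j ∈ Finset.range (q+2), (-1:ℤ)^j * ((q+1).choose j) * (q:ℤ)^(K-j)) (hK : K ≤ q) :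
   A (K+1) = q * A K + (q-1) * (-1)^K * (q.choose K) := by
  have e := Int.alternating_sum_range_choose_of_ne (n := q+1) (by omega)
  have e2 := Int.alternating_sum_range_choose_eq_choose (n := q) (m := K)
  obtain ⟨r, rfl⟩ := Nat.exists_eq_add_of_le hK
  rw [show K + r + 1 + 1 = (K+1)+(r+1) by ring, Finset.sum_range_add] at e
  rw [hA, hA, show K + r + 2 = (K+1)+(r+1) by ring, Finset.sum_range_add _ (K+1) (r+1), Finset.sum_range_add _ (K+1) (r+1)]
  have h1 : ∀ K', K' ≤ K + 1 → ∑ x ∈ Finset.range (r+1), (-1:ℤ)^(K+1+x) * ((K+r+1).choose (K+1+x)) * ((K+r:ℕ):ℤ)^(K' - (K+1+x)) = ∑ x ∈ Finset.range (r+1), (-1:ℤ)^(K+1+x) * ((K+r+1).choose (K+1+x)) := by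
    intro K' h
    apply Finset.sum_congr rfl
    intro x _
    rw [show K' - (K+1+x) = 0 by omega]; simp
  rw [h1 _ le_rfl, h1 _ (by omega)]
  have h2 : ∑ j ∈ Finset.range (K+1), (-1:ℤ)^j * ((K+r+1).choose j) * ((K+r:ℕ):ℤ)^(K+1-j) = ((K+r:ℕ):ℤ) * ∑ j ∈ Finset.range (K+1), (-1:ℤ)^j * ((K+r+1).choose j) * ((K+r:ℕ):ℤ)^(K-j) := by
    rw [Finset.mul_sum]
    apply Finset.sum_congr rfl
    intro x hx
    have := Finset.mem_range.1 hx
    rw [show K + 1 - x = (K-x)+1 by omega, pow_succ]; ring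
  rw [h2]
  rw [e2] at e
  linear_combination (1 - ((K+r:ℕ):ℤ)) * e

theorem choose_lt (q m : ℕ) (h : m ≤ q) (hm : 1 ≤ m): q.choose (m+1) < q * q.choose m := by
  have h1 := Nat.choose_succ_right_eq q m
  have h2 := Nat.choose_pos h
  obtain ⟨r, rfl⟩ := Nat.exists_eq_add_of_le h
  rw [Nat.add_sub_cancel_left] at h1
  have : (m+r).choose m * r ≤ (m+r).choose m * (m + r) := by gcongr; omega
  nlinarith

theorem A_pos (q K : ℕ) (hq : 2 ≤ q) (A : ℕ → ℤ) (hA : ∀ K, A K = ∑ j ∈ Finset.range (q+2), (-1:ℤ)^j * ((q+1).choose j) * (q:ℤ)^(K-j)) (hK : K ≤ q) (h1 : 1 ≤ K) (h2 : K ≠ 2) : 0 < A K := by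
  have hr := fun K => A_rec q K A hA
  have h0 : A 0 = 0 := by
    rw [hA]; simpa using Int.alternating_sum_range_choose_of_ne (n := q+1) (by omega)
  have hqz : (2:ℤ) ≤ q := by exact_mod_cast hq
  have step : ∀ m, 2*m+1 ≤ q → A (2*m+2) = q*(q*A (2*m)) + (q-1)*(q * q.choose (2*m) - q.choose (2*m+1)) := by
    intro m hm
    rw [hr (2*m+1) hm, hr (2*m) (by omega)]
    simp [pow_succ, pow_mul]; ring
  have A2 : A 2 = 0 := by
    have := step 0 (by omega)
    simpa [h0] using this
  have ev : ∀ m, 2*m+4 ≤ q+1 → 0 < A (2*m+4) := by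
    intro m
    have key : ∀ m, 1 ≤ m → 2*m+2 ≤ q+1 → 0 ≤ A (2*m) → 0 < A (2*m+2) := by
      intro m hm hm' h
      rw [step m (by omega)]
      have : ((q.choose (2*m+1):ℕ):ℤ) < q * q.choose (2*m) := by
        exact_mod_cast choose_lt q (2*m) (by omega) (by omega)
      have : 0 < ((q:ℤ)-1)*(q * q.choose (2*m) - q.choose (2*m+1)) := mul_pos (by linarith) (by linarith)
      have : 0 ≤ (q:ℤ)*(q*A (2*m)) := by positivity
      linarith
    induction m with
    | zero => intro h; exact key 1 le_rfl (by omega) (by simp [A2])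
    | succ m ih => intro h; exact key (m+2) (by omega) (by omega) (ih (by omega)).le
  have ev0 : ∀ m, 2*m ≤ q → 0 ≤ A (2*m) := by
    intro m hm
    rcases m with _ | _ | m
    · simp [h0]
    · simp [A2]
    · exact (ev m (by omega)).le
  rcases Nat.even_or_odd' K with ⟨m, rfl | rfl⟩
  · obtain ⟨m, rfl⟩ := Nat.exists_eq_add_of_le (show 2 ≤ m by omega)
    have := ev m (by omega)
    convert this using 2; ring
  · rw [hr _ (by omega)]
    have := ev0 m (by omega)
    have h3 : (0:ℤ) < q.choose (2*m) := by exact_mod_cast Nat.choose_pos (by omega)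
    have : 0 < ((q:ℤ)-1) * (q.choose (2*m)) := mul_pos (by linarith) h3
    have : 0 ≤ (q:ℤ)*A (2*m) := by positivity
    simp [pow_mul]; linarith

theorem count_S {n k : ℕ} {F : Type*} [Field F] [Fintype F] [DecidableEq F]
    (C : Submodule F (Fin n → F)) (hdim : Module.finrank F C = k)
    (hmds : ∀ u ∈ C, u ≠ 0 → n - k + 1 ≤ hammingNorm u) (S : Finset (Fin n)) :
    Nat.card {u : Fin n → F | u ∈ dualCode C ∧ ∀ i ∈ S, u i = 0} = Fintype.card F ^ (n - k - S.card) := by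
  have hle : ∀ S : Finset (Fin n), S.card ≤ n - k →
    Nat.card {u : Fin n → F | u ∈ dualCode C ∧ ∀ i ∈ S, u i = 0} = Fintype.card F ^ (n - k - S.card) := by
    intro S hS
    let W := C ⊔ Pi.spanSubset F (S : Set (Fin n))
    have hdis : C ⊓ Pi.spanSubset F (S : Set (Fin n)) = ⊥ := by
      rw [eq_bot_iff]
      rintro u ⟨hu, hu2⟩
      by_contra h
      have h1 := hmds u hu h
      have h2 : hammingNorm u ≤ S.card := by
        apply Finset.card_le_card
        intro i hi
        by_contra hiS
        have hi' : u i ≠ 0 := by simpa using hi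
        exact hi' ((Pi.mem_spanSubset_iff).1 hu2 i (by simpa using hiS))
      omega
    have hW := Submodule.finrank_sup_add_finrank_inf_eq C (Pi.spanSubset F (S : Set (Fin n)))
    rw [hdis, finrank_bot, hdim, Pi.dim_spanSubset, Set.ncard_coe_finset, add_zero] at hW
    have hA := Subspace.finrank_add_finrank_dualAnnihilator_eq W
    rw [show Module.finrank F W = _ from hW, Module.finrank_fin_fun] at hA
    rw [show n - k - S.card = Module.finrank F W.dualAnnihilator by omega, ← Nat.card_eq_fintype_card,
      ← Module.natCard_eq_pow_finrank (K := F) (V := W.dualAnnihilator)]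
    apply Nat.card_congr
    refine (dotProductEquiv F (Fin n)).toEquiv.subtypeEquiv ?_
    intro u
    change _ ↔ dotProductEquiv F (Fin n) u ∈ W.dualAnnihilator
    simp only [W, Submodule.dualAnnihilator_sup_eq, Submodule.mem_inf]
    refine and_congr ?_ ?_
    · rw [Submodule.mem_dualAnnihilator]; rfl
    · rw [Submodule.mem_dualAnnihilator]
      constructor
      · intro h w hw
        change ∑ i, u i * w i = 0
        apply Finset.sum_eq_zero
        intro i _
        by_cases hi : i ∈ S
        · simp [h i hi]
        · rw [(Pi.mem_spanSubset_iff).1 hw i (by simpa using hi), mul_zero]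
      · intro h i hi
        have := h (Pi.single i 1) (by
          rw [Pi.mem_spanSubset_iff]; intro j hj
          rw [Pi.single_eq_of_ne]; rintro rfl; exact hj (by simpa using hi))
        simpa using this
  rcases le_total S.card (n-k) with h | h
  · exact hle S h
  · obtain ⟨T, hT, hTc⟩ := Finset.exists_subset_card_eq h
    have h1 := hle T hTc.le
    rw [hTc, Nat.sub_self, pow_zero] at h1
    rw [Nat.sub_eq_zero_of_le h, pow_zero]
    apply le_antisymm
    · rw [← h1]
      exact Nat.card_mono (Set.toFinite _) (fun u hu => ⟨hu.1, fun i hi => hu.2 i (hT hi)⟩)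
    · apply Nat.card_pos_iff.2
      refine ⟨⟨0, ?_, ?_⟩, inferInstance⟩ <;> simp [dualCode]

/-- Corollary 4.8: for `k ≠ q - 1`, the dual of a `[q+1,k]_q` MDS code contains a
codeword of weight `q+1`. -/
theorem dual_of_MDS_length_q_add_one_has_full_weight_codeword
    (q k : ℕ) (hq : IsPrimePow q) (hk1 : 1 ≤ k) (hkq : k ≤ q) (hkq1 : k ≠ q - 1)
    (F : Type*) [Field F] [Fintype F] [DecidableEq F] (hF : Fintype.card F = q)
    (C : Submodule F (Fin (q + 1) → F)) (hdim : Module.finrank F C = k)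
    (hmds : minDist C = q - k + 2) :
    ∃ u ∈ dualCode C, hammingNorm u = q + 1 := by
  classical
  have hcount := count_S C hdim (by
    intro u hu h0
    have : minDist C ≤ hammingNorm u := Nat.sInf_le ⟨u, hu, h0, rfl⟩
    omega)
  have hIE := Finset.inclusion_exclusion_card_inf_compl (α := dualCode C) (Finset.univ : Finset (Fin (q+1)))
    (fun i => Finset.univ.filter (fun u => u.1 i = 0))
  have hpos := A_pos q (q+1-k) hq.two_le _ (fun _ => rfl) (by omega) (by omega) (by omega)
  have heq : ∀ t : Finset (Fin (q+1)), (t.inf (fun i => Finset.univ.filter (fun u : dualCode C => u.1 i = 0))).card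
      = q ^ (q + 1 - k - t.card) := by
    intro t
    have h := hcount t
    rw [hF] at h
    rw [← h, Nat.card_eq_card_toFinset, ← Finset.card_map (Function.Embedding.subtype _)]
    congr 1
    ext u
    simp [Finset.mem_inf, and_comm]
  simp_rw [heq] at hIE
  rw [Finset.sum_powerset_apply_card (fun j => (-1:ℤ)^j * ((q ^ (q+1-k-j) : ℕ):ℤ))] at hIE
  have : 0 < (Finset.univ.inf (fun i => (Finset.univ.filter (fun u : dualCode C => u.1 i = 0))ᶜ)).card := by
    zify
    rw [hIE]
    convert hpos using 1
    simp only [Finset.card_univ, Fintype.card_fin]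
    apply Finset.sum_congr rfl
    intro x _
    simp; ring
  obtain ⟨u, hu⟩ := Finset.card_pos.1 this
  refine ⟨u.1, u.2, ?_⟩
  rw [Finset.mem_inf] at hu
  have : ∀ i, u.1 i ≠ 0 := fun i => by simpa using hu i (Finset.mem_univ i)
  simp [hammingNorm, this]
end

section
/- Let q be a prime power and d an integer with 3 < d < q. Then there exists a subset Γ of the symmetric group S_{q+1} whose distinct elements have pairwise Hamming distance at least d and such that |Γ| ≥ (q+1)! / (2·q^{d−2}). -/
open Nat

lemma exists_shift {F : Type} [Field F] [Fintype F] (k : ℕ) (hk : 2 ≤ k) :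
    ∃ c : F, ∀ x : F, x ^ k - x ^ (k - 1) - c ≠ 0 := by
  by_contra! h
  have hs : Function.Surjective (fun x : F => x ^ k - x ^ (k - 1)) := by
    intro c
    obtain ⟨x, hx⟩ := h c
    exact ⟨x, sub_eq_zero.1 hx⟩
  have hi := Finite.injective_iff_surjective.2 hs
  have h1 : k ≠ 0 := by omega
  have h2 : k - 1 ≠ 0 := by omega
  have := @hi 0 1 (by simp [h1, h2])
  exact zero_ne_one this

open Polynomial in
lemma core {F : Type} [Field F] [Fintype F] [DecidableEq F] (k : ℕ) (hk : 2 ≤ k) (c : F)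
    (hg : ∀ x : F, x ^ k - x ^ (k - 1) - c ≠ 0) (u : Option F → F)
    (hsum : ∑ o, u o = 0)
    (hS : ∀ j < k, ∑ x : F, u (some x) / (x ^ k - x ^ (k - 1) - c) * x ^ j = 0)
    (hcard : (Finset.univ.filter fun o => u o ≠ 0).card ≤ k + 1) : u = 0 := by
  rw [Fintype.sum_option] at hsum
  have hSk : ∑ x : F, u (some x) / (x ^ k - x ^ (k - 1) - c) * x ^ k = - u none := by
    have h0 := hS 0 (by omega)
    have h1 := hS (k - 1) (by omega)
    have : ∀ x : F, u (some x) / (x ^ k - x ^ (k - 1) - c) * x ^ k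
        = u (some x) + u (some x) / (x ^ k - x ^ (k - 1) - c) * x ^ (k - 1)
          + c * (u (some x) / (x ^ k - x ^ (k - 1) - c) * x ^ 0) := by
      intro x
      have := div_mul_cancel₀ (u (some x)) (hg x)
      linear_combination this
    rw [Finset.sum_congr rfl fun x _ => this x, Finset.sum_add_distrib, Finset.sum_add_distrib,
      ← Finset.mul_sum, h0, h1]
    linear_combination hsum
  have hp : ∀ p : F[X], p.natDegree ≤ k →
      ∑ x : F, u (some x) / (x ^ k - x ^ (k - 1) - c) * p.eval x = - (p.coeff k * u none) := by
    intro p hpk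
    have : ∀ x : F, u (some x) / (x ^ k - x ^ (k - 1) - c) * p.eval x
        = ∑ j ∈ Finset.range (k + 1),
          p.coeff j * (u (some x) / (x ^ k - x ^ (k - 1) - c) * x ^ j) := by
      intro x
      rw [eval_eq_sum_range' (by omega : p.natDegree < k + 1), Finset.mul_sum]
      exact Finset.sum_congr rfl fun j _ => by ring
    rw [Finset.sum_congr rfl fun x _ => this x, Finset.sum_comm]
    simp_rw [← Finset.mul_sum]
    rw [Finset.sum_range_succ, hSk, Finset.sum_eq_zero]
    · ring
    · intro j hj
      rw [hS j (Finset.mem_range.1 hj), mul_zero]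
  have hfin : ∀ x0 : F, u (some x0) = 0 := by
    intro x0
    by_contra hx0
    set T : Finset F := Finset.univ.filter fun x => u (some x) ≠ 0 with hT
    have hmem : x0 ∈ T := by simp [hT, hx0]
    set p : F[X] := ∏ y ∈ T.erase x0, (X - C y) with hpdef
    have hdeg : p.natDegree = T.card - 1 := by
      rw [hpdef, natDegree_prod_of_monic _ _ fun y _ => monic_X_sub_C y]
      simp [Finset.card_erase_of_mem hmem]
    have hTc : T.card + (if u none ≠ 0 then 1 else 0) ≤ k + 1 := by
      have hsub : T.map Function.Embedding.some ∪ (if u none ≠ 0 then {none} else ∅)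
          ⊆ Finset.univ.filter fun o => u o ≠ 0 := by
        intro o ho
        cases o with
        | none => 
          by_cases h : u none = 0
          · simp [h] at ho
          · simp [h]
        | some x =>
          by_cases h : u none = 0
          · simpa [h, hT] using ho
          · simpa [h, hT] using ho
      have h2 := (Finset.card_le_card hsub).trans hcard
      rw [Finset.card_union_of_disjoint, Finset.card_map] at h2
      · by_cases h : u none = 0
        · simpa [h] using h2
        · simpa [h] using h2
      · by_cases h : u none = 0 <;> simp [h]
    have hpos : 0 < T.card := Finset.card_pos.2 ⟨x0, hmem⟩
    have hz : p.coeff k * u none = 0 := by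
      by_cases h : u none = 0
      · simp [h]
      · rw [if_pos h] at hTc
        rw [coeff_eq_zero_of_natDegree_lt (by omega), zero_mul]
    have hk' := hp p (by split_ifs at hTc <;> omega)
    rw [hz, neg_zero, Finset.sum_eq_single x0] at hk'
    · have hne : p.eval x0 ≠ 0 := by
        rw [hpdef, eval_prod, Finset.prod_ne_zero_iff]
        intro y hy
        simpa [sub_eq_zero] using (Finset.ne_of_mem_erase hy).symm
      exact mul_ne_zero (div_ne_zero hx0 (hg x0)) hne hk'
    · intro y _ hy
      by_cases h : u (some y) = 0
      · simp [h]
      · have : p.eval y = 0 := by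
          rw [hpdef, eval_prod]
          exact Finset.prod_eq_zero (i := y) (by simp [hT, hy, h]) (by simp)
        rw [this, mul_zero]
    · simp
  funext o
  cases o with
  | some x => exact hfin x
  | none => simpa [hfin] using hsum

/-- Two even permutations agreeing after merging the symbols `a`, `b` are equal. -/
lemma even_inj {α : Type} [Fintype α] [DecidableEq α] (a b : α) (hab : a ≠ b) {β : Type}
    (m : α → β) (hm : ∀ i j, m i = m j → i = j ∨ (i = a ∧ j = b) ∨ (i = b ∧ j = a))
    (σ τ : Equiv.Perm α) (hs : Equiv.Perm.sign σ = Equiv.Perm.sign τ)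
    (h : ∀ i, m (σ i) = m (τ i)) : σ = τ := by
  by_contra hne
  have key : ∀ i, σ i = τ i ∨ σ i = Equiv.swap a b (τ i) := by
    intro i
    rcases hm _ _ (h i) with h | ⟨h1, h2⟩ | ⟨h1, h2⟩
    · exact Or.inl h
    · right; rw [h1, h2]; simp
    · right; rw [h1, h2]; simp
  obtain ⟨i, hi⟩ : ∃ i, σ i ≠ τ i := by
    by_contra! h'
    exact hne (Equiv.ext h')
  have hsw : σ = Equiv.swap a b * τ := by
    have hA : ∀ x y, (τ x = a ∧ τ y = b ∨ τ x = b ∧ τ y = a) → σ x ≠ τ x → σ y ≠ τ y := by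
      intro x y hxy hx hy
      have h1 := (key x).resolve_left hx
      have h2 : σ x = τ y := by
        rcases hxy with ⟨h3, h4⟩ | ⟨h3, h4⟩ <;> rw [h1, h3, h4] <;> simp
      have : x = y := σ.injective (h2.trans hy.symm)
      subst this
      exact hx hy
    have hi' : τ i = a ∨ τ i = b := by
      by_contra! h'
      have := (key i).resolve_left hi
      rw [Equiv.swap_apply_of_ne_of_ne h'.1 h'.2] at this
      exact hi this
    ext x
    simp only [Equiv.Perm.mul_apply]
    rcases key x with hx | hx
    · rw [hx]
      by_cases hxa : τ x = a
      · exfalso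
        rcases hi' with h1 | h1
        · exact hi ((τ.injective (h1.trans hxa.symm)) ▸ hx)
        · exact hA i x (Or.inr ⟨h1, hxa⟩) hi hx
      by_cases hxb : τ x = b
      · exfalso
        rcases hi' with h1 | h1
        · exact hA i x (Or.inl ⟨h1, hxb⟩) hi hx
        · exact hi ((τ.injective (h1.trans hxb.symm)) ▸ hx)
      rw [Equiv.swap_apply_of_ne_of_ne hxa hxb]
    · exact hx
  rw [hsw, Equiv.Perm.sign_mul, Equiv.Perm.sign_swap hab] at hs
  rcases Int.units_eq_one_or (Equiv.Perm.sign τ) with h1 | h1 <;> rw [h1] at hs <;>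
    exact absurd hs (by decide)

lemma main_field {F : Type} [Field F] [Fintype F] [DecidableEq F] (q d : ℕ)
    (hF : Fintype.card F = q) (hd3 : 3 < d) :
    ∃ Γ : Finset (Equiv.Perm (Fin (q + 1))),
      (∀ σ ∈ Γ, ∀ τ ∈ Γ, σ ≠ τ → d ≤ permDist σ τ) ∧
      ((q + 1)! : ℝ) / (2 * (q : ℝ) ^ (d - 2)) ≤ Γ.card := by
  obtain ⟨c, hc⟩ := exists_shift (F := F) (d - 2) (by omega)
  have hcO : Fintype.card (Option F) = q + 1 := by rw [Fintype.card_option, hF]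
  let e : Fin (q + 1) ≃ Option F := (Fintype.equivFinOfCardEq hcO).symm
  have hq : 0 < q := hF ▸ Fintype.card_pos
  haveI : Nontrivial (Fin (q + 1)) := Fin.nontrivial_iff_two_le.2 (by omega)
  let m : Fin (q + 1) → F := fun i => (e i).getD 0
  let v : Equiv.Perm (Fin (q + 1)) → Option F → F := fun σ o => m (σ (e.symm o))
  let f : alternatingGroup (Fin (q + 1)) → (Fin (d - 2) → F) := fun σ j =>
    ∑ x : F, v σ.1 (some x) / (x ^ (d - 2) - x ^ (d - 2 - 1) - c) * x ^ (j : ℕ)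
  have hcardA : 2 * (Fintype.card (alternatingGroup (Fin (q + 1))) : ℝ) = (q + 1)! := by
    have := two_mul_card_alternatingGroup (α := Fin (q + 1))
    rw [Fintype.card_perm, Fintype.card_fin] at this
    exact_mod_cast this
  have hq' : (0 : ℝ) < q := by exact_mod_cast hq
  obtain ⟨y, hy⟩ := Fintype.exists_le_card_fiber_of_nsmul_le_card (f := f)
    (b := ((q + 1)! : ℝ) / (2 * (q : ℝ) ^ (d - 2))) (by
      rw [Fintype.card_fun, hF, Fintype.card_fin, nsmul_eq_mul, ← hcardA]
      push_cast
      apply le_of_eq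
      field_simp)
  refine ⟨(Finset.univ.filter fun σ => f σ = y).map (Function.Embedding.subtype _), ?_, ?_⟩
  · intro σ hσ τ hτ hne
    simp only [Finset.mem_map, Finset.mem_filter, Finset.mem_univ, true_and] at hσ hτ
    obtain ⟨σ, hσ, rfl⟩ := hσ
    obtain ⟨τ, hτ, rfl⟩ := hτ
    by_contra hlt
    apply hne
    have hu := core (d - 2) (by omega) c hc (fun o => v σ.1 o - v τ.1 o) (by
        rw [Finset.sum_sub_distrib, sub_eq_zero]
        have : ∀ ρ : Equiv.Perm (Fin (q + 1)), ∑ o, v ρ o = ∑ i, m i := fun ρ =>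
          Equiv.sum_comp (e.symm.trans ρ) m
        rw [this, this]) (by
        intro j hj
        have := congrFun (hσ.trans hτ.symm) ⟨j, hj⟩
        simp only [f] at this
        simp only [sub_div, sub_mul, Finset.sum_sub_distrib] at this ⊢
        rw [this, sub_self]) (by
        have hle : (Finset.univ.filter fun o => v σ.1 o - v τ.1 o ≠ 0).card
            ≤ permDist σ.1 τ.1 := by
          unfold permDist hammingDist
          apply Finset.card_le_card_of_injOn e.symm
          · intro o ho
            simp only [Finset.coe_filter, Finset.mem_univ, true_and, Set.mem_setOf_eq] at ho ⊢
            intro h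
            apply ho
            simp only [v]
            rw [h, sub_self]
          · exact e.symm.injective.injOn
        have : permDist σ.1 τ.1 < d := not_le.1 hlt
        omega)
    refine even_inj (e.symm none) (e.symm (some 0)) (by simp) m ?_ σ.1 τ.1 ?_ ?_
    · intro i j hij
      simp only [m] at hij
      simp only [Equiv.eq_symm_apply]
      rw [← e.injective.eq_iff]
      clear_value e
      generalize e i = a at hij ⊢
      generalize e j = b at hij ⊢
      rcases a with _ | x <;> rcases b with _ | z <;> simp at hij ⊢
      · exact hij.symm
      · exact hij
      · exact hij
    · rw [Equiv.Perm.mem_alternatingGroup.1 σ.2, Equiv.Perm.mem_alternatingGroup.1 τ.2]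
    · intro i
      have := congrFun hu (e i)
      simpa [v, sub_eq_zero] using this
  · rw [Finset.card_map]
    exact hy

/-- Theorem 4.9: for every prime power `q` and every `3 < d < q`, there is a permutation
code in `S_{q+1}` of minimum distance at least `d` and size at least `(q+1)!/(2·q^(d-2))`. -/
theorem perm_code_lower_bound_MDS_q_add_one
    (q d : ℕ) (hq : IsPrimePow q) (hd3 : 3 < d) (hdq : d < q) :
    ∃ Γ : Finset (Equiv.Perm (Fin (q + 1))),
      (∀ σ ∈ Γ, ∀ τ ∈ Γ, σ ≠ τ → d ≤ permDist σ τ) ∧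
      ((q + 1)! : ℝ) / (2 * (q : ℝ) ^ (d - 2)) ≤ Γ.card := by
  classical
  obtain ⟨p, n, hp, hn, rfl⟩ := (isPrimePow_nat_iff q).1 hq
  haveI : Fact p.Prime := ⟨hp⟩
  haveI : Fintype (GaloisField p n) := Fintype.ofFinite _
  exact main_field (F := GaloisField p n) (p ^ n) d
    (by rw [← Nat.card_eq_fintype_card]; exact GaloisField.card p n hn.ne') hd3
end

section
/- Let q be a prime power and n, k positive integers with 1 ≤ k ≤ q − 2. If C is a k-dimensional subspace of F_q^n whose minimum Hamming distance is at least 2, then the dual code C⊥ contains a codeword of Hamming weight n, i.e., a codeword all of whose coordinates are nonzero. -/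
open Nat

theorem exists_small_dual_word {F : Type*} [Field F] [DecidableEq F] {n : ℕ}
    (C : Submodule F (Fin n → F))
    (hmind : ∀ u ∈ C, u ≠ 0 → 2 ≤ hammingNorm u) (i : Fin n) :
    ∃ w ∈ dualCode C, ∃ T : Finset (Fin n), T.card ≤ Module.finrank F C ∧
      w i = 1 ∧ ∀ j, j ≠ i → j ∉ T → w j = 0 := by
  classical
  let f : Fin n → Module.Dual F C := fun j => (LinearMap.proj j).comp C.subtype
  let g : {j : Fin n // j ≠ i} → Module.Dual F C := fun j => f j
  have hmem : f i ∈ Submodule.span F (Set.range g) := by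
    by_contra hnot
    obtain ⟨p, hp, hp0⟩ := Submodule.exists_le_ker_of_notMem hnot
    obtain ⟨c, rfl⟩ := (Module.evalEquiv F C).surjective p
    have hci : (c : Fin n → F) i ≠ 0 := by simpa [f] using hp
    have hcj : ∀ j, j ≠ i → (c : Fin n → F) j = 0 := by
      intro j hj
      have := hp0 (Submodule.subset_span ⟨⟨j, hj⟩, rfl⟩)
      simpa [f, g] using this
    have h2 := hmind c c.2 (fun h => hci (by rw [h]; rfl))
    have h1 : hammingNorm (c : Fin n → F) ≤ ({i} : Finset (Fin n)).card := by
      apply Finset.card_le_card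
      intro j hj
      by_contra hji
      simp only [Finset.mem_singleton] at hji
      simp [hcj j hji] at hj
    simp at h1
    omega
  obtain ⟨κ, a, ha, hspan, hli⟩ := exists_linearIndependent' F g
  haveI : Finite κ := Finite.of_injective a ha
  haveI : Fintype κ := Fintype.ofFinite κ
  rw [← hspan, Submodule.mem_span_range_iff_exists_fun] at hmem
  obtain ⟨d, hd⟩ := hmem
  refine ⟨Pi.single i 1 - ∑ x, d x • Pi.single (a x : Fin n) 1, ?_,
    Finset.univ.image (fun x => (a x : Fin n)), ?_, ?_, ?_⟩
  · intro c hc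
    have h := LinearMap.congr_fun hd ⟨c, hc⟩
    simp [f, g, LinearMap.sum_apply] at h
    simp only [Pi.sub_apply, Finset.sum_apply, Pi.smul_apply, smul_eq_mul, sub_mul,
      Finset.sum_sub_distrib, Finset.sum_mul]
    rw [Finset.sum_comm]
    simp [Pi.single_apply, h]
  · refine Finset.card_image_le.trans ?_
    have := hli.fintype_card_le_finrank
    rwa [Subspace.dual_finrank_eq] at this
  · simp only [Pi.sub_apply, Finset.sum_apply, Pi.smul_apply, smul_eq_mul, Pi.single_eq_same]
    rw [Finset.sum_eq_zero, sub_zero]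
    intro x _
    rw [Pi.single_eq_of_ne (a x).2.symm, mul_zero]
  · intro j hj hjT
    simp only [Pi.sub_apply, Finset.sum_apply, Pi.smul_apply, smul_eq_mul]
    rw [Finset.sum_eq_zero, Pi.single_eq_of_ne hj, sub_zero]
    intro x _
    rw [Pi.single_eq_of_ne, mul_zero]
    rintro rfl
    exact hjT (Finset.mem_image_of_mem _ (Finset.mem_univ x))

/-- Lemma 5.2: if `C` is an `[n,k,d]_q` code with `d ≥ 2` and `k ≤ q - 2`, then
the dual of `C` contains a codeword of full weight `n`. -/
theorem dual_has_full_weight_codeword_of_dim_le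
    (q n k : ℕ) (hq : IsPrimePow q) (hn : 0 < n) (hk1 : 1 ≤ k) (hkq : k ≤ q - 2)
    (F : Type*) [Field F] [Fintype F] [DecidableEq F] (hF : Fintype.card F = q)
    (C : Submodule F (Fin n → F)) (hdim : Module.finrank F C = k)
    (hmind : ∀ u ∈ C, u ≠ 0 → 2 ≤ hammingNorm u) :
    ∃ u ∈ dualCode C, hammingNorm u = n := by
  classical
  have hstep : ∀ S : Finset (Fin n), ∃ u ∈ dualCode C, ∀ j ∈ S, u j ≠ 0 := by
    intro S
    induction S using Finset.induction_on with
    | empty => exact ⟨0, fun c _ => by simp, by simp⟩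
    | insert i S _ ih =>
      obtain ⟨u, hu, huS⟩ := ih
      by_cases hui : u i = 0
      swap
      · refine ⟨u, hu, ?_⟩
        intro j hj
        rcases Finset.mem_insert.1 hj with rfl | hj
        exacts [hui, huS j hj]
      obtain ⟨w, hw, T, hT, hwi, hwT⟩ := exists_small_dual_word C hmind i
      have hcard : (insert 0 (T.image fun j => - u j / w j)).card
          < (Finset.univ : Finset F).card := by
        have h1 := Finset.card_insert_le (0 : F) (T.image fun j => - u j / w j)
        have h2 : (T.image fun j => - u j / w j).card ≤ T.card := Finset.card_image_le
        rw [Finset.card_univ, hF]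
        omega
      obtain ⟨t, -, ht⟩ := Finset.exists_mem_notMem_of_card_lt_card hcard
      simp only [Finset.mem_insert, Finset.mem_image, not_or, not_exists, not_and] at ht
      obtain ⟨ht0, htT⟩ := ht
      refine ⟨u + t • w, ?_, ?_⟩
      · intro c hc
        have h1 := hu c hc
        have h2 := hw c hc
        simp only [Pi.add_apply, Pi.smul_apply, smul_eq_mul, add_mul, Finset.sum_add_distrib,
          mul_assoc, ← Finset.mul_sum, h1, h2, mul_zero, add_zero]
      · intro j hj
        simp only [Pi.add_apply, Pi.smul_apply, smul_eq_mul]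
        by_cases hji : j = i
        · subst hji
          simpa [hui, hwi] using ht0
        have hjS : j ∈ S := (Finset.mem_insert.1 hj).resolve_left hji
        by_cases hwj : w j = 0
        · simpa [hwj] using huS j hjS
        have hjT : j ∈ T := by
          by_contra h
          exact hwj (hwT j hji h)
        intro h0
        apply htT j hjT
        rw [div_eq_iff hwj]
        linear_combination -h0
  obtain ⟨u, hu, h⟩ := hstep Finset.univ
  refine ⟨u, hu, ?_⟩
  have : (Finset.univ.filter fun j => u j ≠ 0) = Finset.univ :=
    Finset.filter_true_of_mem h
  simp [hammingNorm, this]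
end

section
/- Let n, r be positive integers with r ≤ n, and let K be the subgroup of the symmetric group S_{2n} generated by the r disjoint transpositions (1 2), (3 4), …, (2r−1 2r). Then for every positive integer d, the maximum cardinality of a subset of K whose distinct elements have pairwise Hamming distance at least d equals A_2(r, ⌈d/2⌉), the maximum cardinality of a binary code of length r whose distinct elements have pairwise Hamming distance at least ⌈d/2⌉. (The paper states this with ⌊d/2⌋, which coincides with ⌈d/2⌉ for even d.) -/
open Nat

/-- `A_2(r,e)`: the maximum cardinality of a binary code of length `r` whose distinct
elements have pairwise Hamming distance at least `e`. -/
noncomputable def A2 (r e : ℕ) : ℕ :=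
  sSup {m | ∃ C : Finset (Fin r → ZMod 2), C.card = m ∧
    ∀ u ∈ C, ∀ v ∈ C, u ≠ v → e ≤ hammingDist u v}

/-- The bit of `v` governing the point `x` (zero outside the first `2r` points). -/
def codeBit {r : ℕ} (v : Fin r → ZMod 2) (x : ℕ) : ℕ :=
  if h : x / 2 < r then (v ⟨x / 2, h⟩).val else 0

lemma codeBit_lt {r : ℕ} (v : Fin r → ZMod 2) (x : ℕ) : codeBit v x < 2 := by
  unfold codeBit
  split_ifs with h
  · exact ZMod.val_lt _
  · norm_num

lemma codeBit_add {r : ℕ} (u v : Fin r → ZMod 2) (x : ℕ) :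
    codeBit (u + v) x = (codeBit u x + codeBit v x) % 2 := by
  unfold codeBit
  split_ifs with h
  · simp [ZMod.val_add]
  · rfl

lemma codeBit_congr {r : ℕ} (v : Fin r → ZMod 2) {x y : ℕ} (h : x / 2 = y / 2) :
    codeBit v x = codeBit v y := by
  unfold codeBit
  simp only [h]

/-- The action of a word on points. -/
def codeFun {n r : ℕ} (v : Fin r → ZMod 2) (x : Fin (2 * n)) : Fin (2 * n) :=
  ⟨2 * (x.val / 2) + (x.val % 2 + codeBit v x.val) % 2, by have := x.isLt; omega⟩

lemma codeFun_add {n r : ℕ} (u v : Fin r → ZMod 2) (x : Fin (2 * n)) :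
    codeFun (u + v) x = codeFun u (codeFun v x) := by
  apply Fin.ext
  have h : codeBit u (2 * (x.val / 2) + (x.val % 2 + codeBit v x.val) % 2) = codeBit u x.val :=
    codeBit_congr u (by omega)
  simp only [codeFun, h, codeBit_add]
  omega

lemma codeFun_zero {n r : ℕ} (x : Fin (2 * n)) :
    codeFun (0 : Fin r → ZMod 2) x = x := by
  apply Fin.ext
  have h : codeBit (0 : Fin r → ZMod 2) x.val = 0 := by
    unfold codeBit
    split_ifs <;> simp
  simp only [codeFun, h]
  omega

lemma word_add_self {r : ℕ} (v : Fin r → ZMod 2) : v + v = 0 := by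
  funext i
  exact CharTwo.add_self_eq_zero (v i)

/-- The permutation attached to a word. -/
def codePerm (n : ℕ) {r : ℕ} (v : Fin r → ZMod 2) : Equiv.Perm (Fin (2 * n)) where
  toFun := codeFun v
  invFun := codeFun v
  left_inv x := by rw [← codeFun_add, word_add_self, codeFun_zero]
  right_inv x := by rw [← codeFun_add, word_add_self, codeFun_zero]

lemma codePerm_add (n : ℕ) {r : ℕ} (u v : Fin r → ZMod 2) :
    codePerm n (u + v) = codePerm n u * codePerm n v :=
  Equiv.ext fun x => codeFun_add u v x

lemma codePerm_zero (n : ℕ) {r : ℕ} : codePerm n (0 : Fin r → ZMod 2) = 1 :=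
  Equiv.ext fun x => codeFun_zero x

/-- `codePerm` as a homomorphism. -/
def codeHom (n r : ℕ) : Multiplicative (Fin r → ZMod 2) →* Equiv.Perm (Fin (2 * n)) where
  toFun v := codePerm n v.toAdd
  map_one' := codePerm_zero n
  map_mul' u v := codePerm_add n u.toAdd v.toAdd

lemma codePerm_single {n r : ℕ} (i : Fin r) (h0 : 2 * i.val < 2 * n)
    (h1 : 2 * i.val + 1 < 2 * n) :
    codePerm n (Pi.single i 1 : Fin r → ZMod 2) =
      Equiv.swap (⟨2 * i.val, h0⟩ : Fin (2 * n)) ⟨2 * i.val + 1, h1⟩ := by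
  ext x
  have hb : codeBit (Pi.single i 1 : Fin r → ZMod 2) x.val = if x.val / 2 = i.val then 1 else 0 := by
    unfold codeBit
    split_ifs with h h' h'
    · have : (⟨x.val / 2, h⟩ : Fin r) = i := Fin.ext h'
      rw [this, Pi.single_eq_same]
      rfl
    · have : (⟨x.val / 2, h⟩ : Fin r) ≠ i := fun e => h' (congrArg Fin.val e)
      rw [Pi.single_eq_of_ne this]
      rfl
    · have := i.isLt
      omega
    · rfl
  change 2 * (x.val / 2) + (x.val % 2 + codeBit _ x.val) % 2 = _
  rw [hb, Equiv.swap_apply_def]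
  simp only [Fin.ext_iff]
  split_ifs <;> (try dsimp only) <;> omega

lemma mem_closure_iff_codePerm {n r : ℕ} (h0 : ∀ i : Fin r, 2 * i.val < 2 * n)
    (h1 : ∀ i : Fin r, 2 * i.val + 1 < 2 * n) (σ : Equiv.Perm (Fin (2 * n))) :
    σ ∈ Subgroup.closure (Set.range (fun i : Fin r =>
          Equiv.swap (⟨2 * i.val, h0 i⟩ : Fin (2 * n)) (⟨2 * i.val + 1, h1 i⟩ : Fin (2 * n)))) ↔
      ∃ v : Fin r → ZMod 2, codePerm n v = σ := by
  constructor
  · intro h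
    have hle : Subgroup.closure (Set.range (fun i : Fin r =>
          Equiv.swap (⟨2 * i.val, h0 i⟩ : Fin (2 * n)) (⟨2 * i.val + 1, h1 i⟩ : Fin (2 * n))))
          ≤ (codeHom n r).range := by
      rw [Subgroup.closure_le]
      rintro _ ⟨i, rfl⟩
      exact ⟨Multiplicative.ofAdd (Pi.single i 1), codePerm_single i (h0 i) (h1 i)⟩
    obtain ⟨v, hv⟩ := hle h
    exact ⟨v.toAdd, hv⟩
  · rintro ⟨v, rfl⟩
    have key : ∀ s : Finset (Fin r), codePerm n (∑ i ∈ s, Pi.single i (v i)) ∈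
        Subgroup.closure (Set.range (fun i : Fin r =>
          Equiv.swap (⟨2 * i.val, h0 i⟩ : Fin (2 * n)) (⟨2 * i.val + 1, h1 i⟩ : Fin (2 * n)))) := by
      intro s
      induction s using Finset.induction_on with
      | empty => rw [Finset.sum_empty, codePerm_zero]; exact one_mem _
      | insert a s ha ih =>
        rw [Finset.sum_insert ha, codePerm_add]
        refine mul_mem ?_ ih
        have hz : ∀ z : ZMod 2, z = 0 ∨ z = 1 := by decide
        rcases hz (v a) with h | h
        · rw [h, Pi.single_zero, codePerm_zero]; exact one_mem _
        · rw [h, codePerm_single a (h0 a) (h1 a)]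
          exact Subgroup.subset_closure ⟨a, rfl⟩
    have := key Finset.univ
    rwa [Finset.univ_sum_single] at this

lemma permDist_codePerm {n r : ℕ} (hrn : r ≤ n) (u v : Fin r → ZMod 2) :
    permDist (codePerm n u) (codePerm n v) = 2 * hammingDist u v := by
  have hlt : ∀ p : Fin r × Fin 2, 2 * p.1.val + p.2.val < 2 * n := by
    intro p
    have := p.1.isLt
    have := p.2.isLt
    omega
  have hset : (Finset.univ.filter fun x : Fin (2 * n) => codePerm n u x ≠ codePerm n v x) =
      ((Finset.univ.filter fun i : Fin r => u i ≠ v i) ×ˢ (Finset.univ : Finset (Fin 2))).image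
        (fun p => (⟨2 * p.1.val + p.2.val, hlt p⟩ : Fin (2 * n))) := by
    ext x
    have hx : codePerm n u x ≠ codePerm n v x ↔ codeBit u x.val ≠ codeBit v x.val := by
      rw [not_iff_not]
      change codeFun u x = codeFun v x ↔ _
      have := codeBit_lt u x.val
      have := codeBit_lt v x.val
      simp only [codeFun, Fin.ext_iff]
      omega
    simp only [Finset.mem_filter, Finset.mem_univ, true_and, hx, Finset.mem_image,
      Finset.mem_product, and_true]
    constructor
    · intro h
      unfold codeBit at h
      split_ifs at h with h'
      · refine ⟨(⟨x.val / 2, h'⟩, ⟨x.val % 2, Nat.mod_lt _ (by norm_num)⟩), ?_, ?_⟩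
        · intro e
          exact h (congrArg ZMod.val e)
        · apply Fin.ext
          simp only []
          omega
      · exact absurd rfl h
    · rintro ⟨⟨i, b⟩, hne, rfl⟩ h
      have hi : (2 * i.val + b.val) / 2 = i.val := by
        have := b.isLt
        omega
      simp only [codeBit, hi, i.isLt, dif_pos] at h
      exact hne (ZMod.val_injective 2 h)
  unfold permDist hammingDist
  rw [hset, Finset.card_image_of_injective, Finset.card_product, Finset.card_univ,
    Fintype.card_fin, mul_comm]
  rintro ⟨i, b⟩ ⟨j, c⟩ h
  have h2 := congrArg Fin.val h
  have := b.isLt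
  have := c.isLt
  simp only [] at h2
  simp only [Prod.mk.injEq, Fin.ext_iff]
  omega

lemma codePerm_injective {n r : ℕ} (hrn : r ≤ n) :
    Function.Injective (codePerm n : (Fin r → ZMod 2) → _) := by
  intro u v h
  have h2 := permDist_codePerm hrn u v
  rw [h] at h2
  simp only [permDist, hammingDist_self] at h2
  exact hammingDist_eq_zero.mp (by omega)

/-- Lemma 5.4: if `K ≤ S_{2n}` is the subgroup generated by the `r` disjoint transpositions
`(1 2), (3 4), …, (2r-1 2r)`, then the maximum size of a permutation code inside `K` of
minimum distance at least `d` equals `A_2(r, ⌈d/2⌉)`. -/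
theorem max_perm_code_in_elementary_abelian_eq_A2
    (n r : ℕ) (hn : 0 < n) (hr : 0 < r) (hrn : r ≤ n) (d : ℕ) (hd : 0 < d) :
    sSup {m | ∃ Γ : Finset (Equiv.Perm (Fin (2 * n))),
        (∀ σ ∈ Γ, σ ∈ Subgroup.closure (Set.range (fun i : Fin r =>
          Equiv.swap (⟨2 * i.val, by have := i.isLt; omega⟩ : Fin (2 * n))
            (⟨2 * i.val + 1, by have := i.isLt; omega⟩ : Fin (2 * n))))) ∧
        (∀ σ ∈ Γ, ∀ τ ∈ Γ, σ ≠ τ → d ≤ permDist σ τ) ∧ Γ.card = m} =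
      A2 r ((d + 1) / 2) := by
  have h0 : ∀ i : Fin r, 2 * i.val < 2 * n := fun i => by have := i.isLt; omega
  have h1 : ∀ i : Fin r, 2 * i.val + 1 < 2 * n := fun i => by have := i.isLt; omega
  unfold A2
  congr 1
  ext m
  constructor
  · rintro ⟨Γ, hK, hdist, rfl⟩
    have himg : (Finset.univ.filter fun v : Fin r → ZMod 2 => codePerm n v ∈ Γ).image
        (codePerm n) = Γ := by
      ext σ
      simp only [Finset.mem_image, Finset.mem_filter, Finset.mem_univ, true_and]
      constructor
      · rintro ⟨v, hv, rfl⟩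
        exact hv
      · intro hσ
        obtain ⟨v, rfl⟩ := (mem_closure_iff_codePerm h0 h1 σ).mp (hK σ hσ)
        exact ⟨v, hσ, rfl⟩
    refine ⟨Finset.univ.filter fun v : Fin r → ZMod 2 => codePerm n v ∈ Γ, ?_, ?_⟩
    · rw [← Finset.card_image_of_injective _ (codePerm_injective hrn), himg]
    · intro u hu v hv huv
      have h := hdist _ (Finset.mem_filter.mp hu).2 _ (Finset.mem_filter.mp hv).2
        ((codePerm_injective hrn).ne huv)
      rw [permDist_codePerm hrn] at h
      omega
  · rintro ⟨C, rfl, hC⟩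
    refine ⟨C.image (codePerm n), ?_, ?_, Finset.card_image_of_injective _ (codePerm_injective hrn)⟩
    · intro σ hσ
      obtain ⟨v, -, rfl⟩ := Finset.mem_image.mp hσ
      exact (mem_closure_iff_codePerm h0 h1 _).mpr ⟨v, rfl⟩
    · intro σ hσ τ hτ hne
      obtain ⟨u, hu, rfl⟩ := Finset.mem_image.mp hσ
      obtain ⟨v, hv, rfl⟩ := Finset.mem_image.mp hτ
      have h := hC u hu v hv (fun e => hne (congrArg _ e))
      rw [permDist_codePerm hrn]
      omega
end

section
/- Let n, d be positive integers with d ≤ n and let q be a prime power with q < n ≤ 2q. Suppose there exists an [n, n−d]_q AMDS code C, i.e., an (n−d)-dimensional subspace of F_q^n with minimum Hamming distance d, such that the dual code C⊥ contains a codeword of Hamming weight n. Then there exists a subset Γ ⊆ S_n whose distinct elements have pairwise Hamming distance at least d and such that |Γ| ≥ n! · A_2(n−q, ⌈d/2⌉) / (2^{n−q} · q^{d−1}). (The paper states this with ⌊d/2⌋, which coincides with ⌈d/2⌉ for even d.) -/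
open Nat

def pcLo {n q : ℕ} (hn2q : n ≤ 2 * q) (j : Fin (n - q)) : Fin n := ⟨j.1, by omega⟩

def pcHi {n q : ℕ} (j : Fin (n - q)) : Fin n := ⟨j.1 + q, by omega⟩

def pcB {n q : ℕ} (hn2q : n ≤ 2 * q) (σ : Equiv.Perm (Fin n)) (j : Fin (n - q)) : ZMod 2 :=
  if σ.symm (pcLo hn2q j) < σ.symm (pcHi j) then 0 else 1

lemma pc_mod_cases {n q : ℕ} (hn2q : n ≤ 2 * q) (x y : Fin n)
    (h : x.1 % q = y.1 % q) : x = y ∨ (∃ j : Fin (n - q), x = pcLo hn2q j ∧ y = pcHi j) ∨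
      ∃ j : Fin (n - q), y = pcLo hn2q j ∧ x = pcHi j := by
  have hx := x.2
  have hy := y.2
  have key : ∀ z : ℕ, z < n → (z < q ∧ z % q = z) ∨ (q ≤ z ∧ z % q = z - q) := by
    intro z hz
    rcases lt_or_ge z q with h1 | h1
    · exact Or.inl ⟨h1, Nat.mod_eq_of_lt h1⟩
    · right
      refine ⟨h1, ?_⟩
      rw [Nat.mod_eq_sub_mod h1, Nat.mod_eq_of_lt (by omega)]
  rcases key x hx with ⟨h1, h2⟩ | ⟨h1, h2⟩ <;> rcases key y hy with ⟨h3, h4⟩ | ⟨h3, h4⟩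
  · left; ext; omega
  · right; left
    refine ⟨⟨x.1, by omega⟩, rfl, ?_⟩
    ext; simp [pcHi]; omega
  · right; right
    refine ⟨⟨y.1, by omega⟩, rfl, ?_⟩
    ext; simp [pcHi]; omega
  · left; ext; omega

lemma pc_lo_ne_hi {n q : ℕ} (hn2q : n ≤ 2 * q) (i j : Fin (n - q)) :
    pcLo hn2q i ≠ pcHi j := by
  intro h
  have := congrArg Fin.val h
  have := i.2
  simp [pcLo, pcHi] at *
  omega

lemma pc_lo_inj {n q : ℕ} (hn2q : n ≤ 2 * q) : Function.Injective (pcLo (n := n) hn2q) := by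
  intro i j h
  have := congrArg Fin.val h
  ext; simpa [pcLo] using this

lemma pc_hi_inj {n q : ℕ} : Function.Injective (pcHi (n := n) (q := q)) := by
  intro i j h
  have := congrArg Fin.val h
  ext; simpa [pcHi] using this

lemma pc_of_hi {n q : ℕ} (hn2q : n ≤ 2 * q) (j : Fin (n - q)) (y : Fin n)
    (h : y.1 % q = (pcHi j : Fin n).1 % q) : y = pcHi j ∨ y = pcLo hn2q j := by
  rcases pc_mod_cases hn2q _ _ h with h | ⟨k, h1, h2⟩ | ⟨k, h1, h2⟩
  · exact Or.inl h
  · right; rw [h1, pc_hi_inj h2]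
  · exact absurd h1.symm (pc_lo_ne_hi hn2q _ _)

lemma pc_of_lo {n q : ℕ} (hn2q : n ≤ 2 * q) (j : Fin (n - q)) (y : Fin n)
    (h : y.1 % q = (pcLo hn2q j : Fin n).1 % q) : y = pcLo hn2q j ∨ y = pcHi j := by
  rcases pc_mod_cases hn2q _ _ h with h | ⟨k, h1, h2⟩ | ⟨k, h1, h2⟩
  · exact Or.inl h
  · exact absurd h2 (pc_lo_ne_hi hn2q _ _)
  · right; rw [h2, pc_lo_inj hn2q h1]

lemma pc_inj_aux {n q : ℕ} (hn2q : n ≤ 2 * q) (σ τ : Equiv.Perm (Fin n))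
    (h : ∀ i, (σ i).1 % q = (τ i).1 % q) (i : Fin n) (j : Fin (n - q))
    (h1 : σ i = pcLo hn2q j) (h2 : τ i = pcHi j) : pcB hn2q σ j ≠ pcB hn2q τ j := by
  have hc := h (σ.symm (pcHi j))
  rw [Equiv.apply_symm_apply] at hc
  have hne : σ.symm (pcHi j) ≠ i := by
    rintro rfl
    rw [Equiv.apply_symm_apply] at h1
    exact pc_lo_ne_hi hn2q _ _ h1.symm
  have h3 : τ (σ.symm (pcHi j)) = pcLo hn2q j := by
    rcases pc_of_hi hn2q j _ hc.symm with h3 | h3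
    · exact absurd (τ.injective (h3.trans h2.symm)) hne
    · exact h3
  have e1 : σ.symm (pcLo hn2q j) = i := by rw [← h1]; simp
  have e2 : τ.symm (pcHi j) = i := by rw [← h2]; simp
  have e3 : τ.symm (pcLo hn2q j) = σ.symm (pcHi j) := by rw [← h3]; simp
  unfold pcB
  rw [e1, e2, e3]
  rcases lt_or_gt_of_ne hne with h4 | h4
  · rw [if_neg h4.asymm, if_pos h4]; exact one_ne_zero
  · rw [if_pos h4, if_neg h4.asymm]; exact zero_ne_one

lemma pc_inj {n q : ℕ} (hn2q : n ≤ 2 * q) (σ τ : Equiv.Perm (Fin n))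
    (h : ∀ i, (σ i).1 % q = (τ i).1 % q) (hb : pcB hn2q σ = pcB hn2q τ) : σ = τ := by
  ext1 i
  rcases pc_mod_cases hn2q _ _ (h i) with h1 | ⟨j, h1, h2⟩ | ⟨j, h1, h2⟩
  · exact h1
  · exact absurd (congrFun hb j) (pc_inj_aux hn2q σ τ h i j h1 h2)
  · exact absurd (congrFun hb j).symm (pc_inj_aux hn2q τ σ (fun i => (h i).symm) i j h1 h2)

lemma pc_dist {n q : ℕ} (hn2q : n ≤ 2 * q) (σ τ : Equiv.Perm (Fin n))
    (h : ∀ i, (σ i).1 % q = (τ i).1 % q) :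
    2 * hammingDist (pcB hn2q σ) (pcB hn2q τ) ≤ permDist σ τ := by
  classical
  have agree : ∀ j, τ (σ.symm (pcLo hn2q j)) = pcLo hn2q j →
      τ (σ.symm (pcHi j)) = pcHi j → pcB hn2q σ j = pcB hn2q τ j := by
    intro j h1 h2
    have e1 : τ.symm (pcLo hn2q j) = σ.symm (pcLo hn2q j) := by
      rw [Equiv.symm_apply_eq, h1]
    have e2 : τ.symm (pcHi j) = σ.symm (pcHi j) := by
      rw [Equiv.symm_apply_eq, h2]
    unfold pcB
    rw [e1, e2]
  have mlo : ∀ j, pcB hn2q σ j ≠ pcB hn2q τ j →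
      τ (σ.symm (pcLo hn2q j)) ≠ pcLo hn2q j := by
    intro j hj h1
    refine hj (agree j h1 ?_)
    have hc := h (σ.symm (pcHi j))
    rw [Equiv.apply_symm_apply] at hc
    rcases pc_of_hi hn2q j _ hc.symm with h3 | h3
    · exact h3
    · exact absurd (σ.symm.injective (τ.injective (h3.trans h1.symm))).symm (pc_lo_ne_hi hn2q _ _)
  have mhi : ∀ j, pcB hn2q σ j ≠ pcB hn2q τ j →
      τ (σ.symm (pcHi j)) ≠ pcHi j := by
    intro j hj h1
    refine hj (agree j ?_ h1)
    have hc := h (σ.symm (pcLo hn2q j))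
    rw [Equiv.apply_symm_apply] at hc
    rcases pc_of_lo hn2q j _ hc.symm with h3 | h3
    · exact h3
    · exact absurd (σ.symm.injective (τ.injective (h3.trans h1.symm))) (pc_lo_ne_hi hn2q _ _)
  unfold permDist hammingDist
  set S : Finset (Fin (n - q)) := Finset.univ.filter fun j => pcB hn2q σ j ≠ pcB hn2q τ j with hS
  have c1 : (S.image fun j => σ.symm (pcLo hn2q j)).card = S.card :=
    Finset.card_image_of_injective _ (σ.symm.injective.comp (pc_lo_inj hn2q))
  have c2 : (S.image fun j => σ.symm (pcHi j)).card = S.card :=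
    Finset.card_image_of_injective _ (σ.symm.injective.comp pc_hi_inj)
  have hdisj : Disjoint (S.image fun j => σ.symm (pcLo hn2q j))
      (S.image fun j => σ.symm (pcHi j)) := by
    rw [Finset.disjoint_left]
    intro a ha hb
    simp only [Finset.mem_image] at ha hb
    obtain ⟨i, -, rfl⟩ := ha
    obtain ⟨j, -, hj⟩ := hb
    exact pc_lo_ne_hi hn2q _ _ (σ.symm.injective hj).symm
  calc 2 * S.card = ((S.image fun j => σ.symm (pcLo hn2q j)) ∪
        (S.image fun j => σ.symm (pcHi j))).card := by
        rw [Finset.card_union_of_disjoint hdisj, c1, c2, two_mul]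
    _ ≤ _ := by
      apply Finset.card_le_card
      intro a ha
      simp only [Finset.mem_union, Finset.mem_image] at ha
      rw [Finset.mem_filter]
      refine ⟨Finset.mem_univ _, ?_⟩
      rcases ha with ⟨j, hj, rfl⟩ | ⟨j, hj, rfl⟩
      · rw [Equiv.apply_symm_apply]
        exact (mlo j (Finset.mem_filter.1 hj).2).symm
      · rw [Equiv.apply_symm_apply]
        exact (mhi j (Finset.mem_filter.1 hj).2).symm

lemma pc_A2 (r e : ℕ) : ∃ D : Finset (Fin r → ZMod 2), D.card = A2 r e ∧
    ∀ u ∈ D, ∀ v ∈ D, u ≠ v → e ≤ hammingDist u v := by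
  have := Nat.sSup_mem (s := {m | ∃ C : Finset (Fin r → ZMod 2), C.card = m ∧
    ∀ u ∈ C, ∀ v ∈ C, u ≠ v → e ≤ hammingDist u v}) ⟨0, ∅, by simp⟩
    ⟨Fintype.card (Fin r → ZMod 2), by rintro m ⟨C, rfl, -⟩; exact Finset.card_le_univ C⟩
  exact this

/-- Classification into at most `q^(d-1)` classes. -/
lemma pc_classes {n d q : ℕ} (hd : 0 < d) (hdn : d ≤ n)
    {F : Type*} [Field F] [Fintype F] [DecidableEq F] (hF : Fintype.card F = q)
    (C : Submodule F (Fin n → F)) (hdim : Module.finrank F C = n - d)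
    (u : Fin n → F) (hu : u ∈ dualCode C) (hu0 : ∀ i, u i ≠ 0) (a : F) :
    ∃ (Q : Type) (_ : Fintype Q), Fintype.card Q = q ^ (d - 1) ∧
      ∃ s : {v : Fin n → F // ∑ i, u i * v i = a} → Q,
        ∀ v w, s v = s w → v.1 - w.1 ∈ C := by
  classical
  let f : (Fin n → F) →ₗ[F] F := ∑ i, u i • LinearMap.proj i
  have hf : ∀ v, f v = ∑ i, u i * v i := by intro v; simp [f]
  have hn : 0 < n := by omega
  have hsurj : Function.Surjective f := by
    intro y
    refine ⟨Pi.single ⟨0, hn⟩ ((u ⟨0, hn⟩)⁻¹ * y), ?_⟩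
    rw [hf, Finset.sum_eq_single ⟨0, hn⟩]
    · simp [hu0]
    · intro b _ hb; simp [hb]
    · simp
  have hK : Module.finrank F (LinearMap.ker f) + 1 = n := by
    have h1 := f.finrank_range_add_finrank_ker
    rw [LinearMap.range_eq_top.2 hsurj] at h1
    simp at h1
    omega
  have hCK : C ≤ LinearMap.ker f := by
    intro c hc
    rw [LinearMap.mem_ker, hf]
    exact hu c hc
  let C' := C.submoduleOf (LinearMap.ker f)
  have hC' : Module.finrank F C' = n - d := by
    rw [← hdim]
    exact (Submodule.submoduleOfEquivOfLe hCK).finrank_eq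
  have hQ : Module.finrank F (LinearMap.ker f ⧸ C') = d - 1 := by
    have := C'.finrank_quotient_add_finrank
    omega
  haveI : Fintype (LinearMap.ker f ⧸ C') := Fintype.ofFinite _
  have hcard : Fintype.card (LinearMap.ker f ⧸ C') = q ^ (d - 1) := by
    rw [Module.card_eq_pow_finrank (K := F), hF, hQ]
  obtain ⟨v0, hv0⟩ := hsurj a
  let s0 : {v : Fin n → F // ∑ i, u i * v i = a} → (LinearMap.ker f ⧸ C') := fun v =>
    Submodule.Quotient.mk ⟨v.1 - v0, by rw [LinearMap.mem_ker, map_sub, hv0, hf, v.2, sub_self]⟩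
  refine ⟨Fin (q ^ (d - 1)), inferInstance, by simp,
    fun v => Fintype.equivFinOfCardEq hcard (s0 v), ?_⟩
  intro v w h
  have h := (Fintype.equivFinOfCardEq hcard).injective h
  have h2 := (Submodule.Quotient.eq _).1 h
  have h3 : (v.1 - v0) - (w.1 - v0) ∈ C := h2
  simpa using h3


/-- Theorem 5.5: if an `[n,n-d,d]_q` AMDS code with a full-weight codeword in its dual
exists, with `q < n ≤ 2q`, then there is a permutation code in `S_n` of minimum distance
at least `d` and size at least `n!·A_2(n-q,⌈d/2⌉)/(2^(n-q)·q^(d-1))`. -/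
theorem perm_code_lower_bound_AMDS
    (n d q : ℕ) (hd : 0 < d) (hdn : d ≤ n) (hq : IsPrimePow q)
    (hqn : q < n) (hn2q : n ≤ 2 * q)
    (F : Type*) [Field F] [Fintype F] [DecidableEq F] (hF : Fintype.card F = q)
    (C : Submodule F (Fin n → F)) (hdim : Module.finrank F C = n - d)
    (hmind : minDist C = d)
    (hdual : ∃ u ∈ dualCode C, hammingNorm u = n) :
    ∃ Γ : Finset (Equiv.Perm (Fin n)),
      (∀ σ ∈ Γ, ∀ τ ∈ Γ, σ ≠ τ → d ≤ permDist σ τ) ∧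
      (n ! : ℝ) * (A2 (n - q) ((d + 1) / 2) : ℝ) /
          (2 ^ (n - q) * (q : ℝ) ^ (d - 1)) ≤ Γ.card := by
  classical
  obtain ⟨u, hu, hun⟩ := hdual
  have hu0 : ∀ i, u i ≠ 0 := by
    have h1 : (Finset.univ.filter fun i => u i ≠ 0) = Finset.univ := by
      apply Finset.eq_univ_of_card
      rw [Fintype.card_fin]
      exact hun
    intro i
    have := Finset.mem_univ i
    rw [← h1] at this
    exact (Finset.mem_filter.1 this).2
  have hq0 : 0 < q := hq.pos
  let e := (Fintype.equivFinOfCardEq hF).symm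
  let ph : Fin n → F := fun i => e ⟨i.1 % q, Nat.mod_lt _ hq0⟩
  have hph : ∀ x y, ph x = ph y → x.1 % q = y.1 % q := by
    intro x y h
    have := e.injective h
    simpa using this
  obtain ⟨Q, _, hQ, s, hs⟩ := pc_classes hd hdn hF C hdim u hu hu0 (∑ i, ph i)
  let v : Equiv.Perm (Fin n) → {v : Fin n → F // ∑ i, u i * v i = ∑ i, ph i} := fun σ =>
    ⟨fun i => (u i)⁻¹ * ph (σ i), by
      rw [← Equiv.sum_comp σ ph]
      exact Finset.sum_congr rfl fun i _ => mul_inv_cancel_left₀ (hu0 i) _⟩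
  obtain ⟨D, hD, hDd⟩ := pc_A2 (n - q) ((d + 1) / 2)
  let G : Q × (Fin (n - q) → ZMod 2) → Finset (Equiv.Perm (Fin n)) := fun p =>
    Finset.univ.filter fun σ => s (v σ) = p.1 ∧ pcB hn2q σ + p.2 ∈ D
  have hG : ∀ p, ∀ σ ∈ G p, ∀ τ ∈ G p, σ ≠ τ → d ≤ permDist σ τ := by
    intro p σ hσ τ hτ hne
    obtain ⟨-, h1, h2⟩ := Finset.mem_filter.1 hσ
    obtain ⟨-, h3, h4⟩ := Finset.mem_filter.1 hτ
    have hC := hs _ _ (h1.trans h3.symm)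
    by_cases h0 : (v σ).1 - (v τ).1 = 0
    · have hmod : ∀ i, (σ i).1 % q = (τ i).1 % q := by
        intro i
        apply hph
        have := congrFun (sub_eq_zero.1 h0) i
        exact mul_left_cancel₀ (inv_ne_zero (hu0 i)) this
      have hbne : pcB hn2q σ ≠ pcB hn2q τ := fun h => hne (pc_inj hn2q σ τ hmod h)
      have h5 := hDd _ h2 _ h4 (fun h => hbne (add_right_cancel h))
      have h6 : hammingDist (pcB hn2q σ + p.2) (pcB hn2q τ + p.2)
          = hammingDist (pcB hn2q σ) (pcB hn2q τ) := by
        simp [hammingDist]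
      have h7 := pc_dist hn2q σ τ hmod
      omega
    · have h5 : d ≤ hammingNorm ((v σ).1 - (v τ).1) := by
        rw [← hmind]
        exact Nat.sInf_le ⟨_, hC, h0, rfl⟩
      refine h5.trans ?_
      unfold permDist hammingDist hammingNorm
      apply Finset.card_le_card
      intro i hi
      rw [Finset.mem_filter] at hi ⊢
      refine ⟨Finset.mem_univ _, fun h => hi.2 ?_⟩
      simp [v, h]
  have hsum : ∑ p, (G p).card = n ! * D.card := by
    have h1 : ∀ p, (G p).card = ∑ σ : Equiv.Perm (Fin n),
        if s (v σ) = p.1 ∧ pcB hn2q σ + p.2 ∈ D then 1 else 0 := by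
      intro p
      rw [Finset.card_filter]
    simp_rw [h1]
    rw [Finset.sum_comm]
    have h2 : ∀ σ : Equiv.Perm (Fin n), (∑ p : Q × (Fin (n - q) → ZMod 2),
        if s (v σ) = p.1 ∧ pcB hn2q σ + p.2 ∈ D then 1 else 0) = D.card := by
      intro σ
      rw [← Finset.card_filter]
      refine Finset.card_bij' (fun p _ => pcB hn2q σ + p.2)
        (fun x _ => (s (v σ), x - pcB hn2q σ)) ?_ ?_ ?_ ?_
      · intro p hp; exact (Finset.mem_filter.1 hp).2.2
      · intro x hx; simp [hx]
      · intro p hp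
        have := (Finset.mem_filter.1 hp).2.1
        ext1
        · exact this
        · simp
      · intro x hx; simp
    simp_rw [h2]
    simp [Fintype.card_perm]
  have hcardP : Fintype.card (Q × (Fin (n - q) → ZMod 2)) = 2 ^ (n - q) * q ^ (d - 1) := by
    rw [Fintype.card_prod, hQ, mul_comm]
    simp [ZMod.card]
  have hpos : (0 : ℝ) < 2 ^ (n - q) * (q : ℝ) ^ (d - 1) := by positivity
  have hne : (Finset.univ : Finset (Q × (Fin (n - q) → ZMod 2))).Nonempty := by
    rw [← Finset.card_pos, Finset.card_univ, hcardP]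
    positivity
  obtain ⟨p, -, hp⟩ := Finset.exists_le_of_sum_le hne
    (f := fun _ => (n ! : ℝ) * (A2 (n - q) ((d + 1) / 2) : ℝ) /
          (2 ^ (n - q) * (q : ℝ) ^ (d - 1))) (g := fun p => ((G p).card : ℝ)) (by
      rw [← Nat.cast_sum, hsum, Finset.sum_const, Finset.card_univ, hcardP, hD, nsmul_eq_mul]
      push_cast
      rw [mul_div_cancel₀ _ hpos.ne'])
  exact ⟨G p, hG p, hp⟩
end

section
/- Let n, d be positive integers with d ≥ 2 and let q be a prime power with q < n ≤ min(2q, q + d − 2). Suppose there exists an [n, n−d]_q AMDS code, i.e., an (n−d)-dimensional subspace of F_q^n with minimum Hamming distance d. Then there exists a subset Γ ⊆ S_n whose distinct elements have pairwise Hamming distance at least d and such that |Γ| ≥ n! · A_2(n−q, ⌈d/2⌉) / (2^{n−q} · q^{d−1}). (The paper states this with ⌊d/2⌋, which coincides with ⌈d/2⌉ for even d.) -/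
open Nat

lemma aux_interp {n d : ℕ} {F : Type*} [Field F] [DecidableEq F]
    (C : Submodule F (Fin n → F)) (hC : ∀ u ∈ C, u ≠ 0 → d ≤ hammingNorm u)
    (S : Finset (Fin n)) (hS : S.card < d) (b : Fin n → F) :
    ∃ ph : Module.Dual F (Fin n → F), ph ∈ C.dualAnnihilator ∧
      ∀ i ∈ S, ph (Pi.single i 1) = b i := by
  let ι : (S → F) →ₗ[F] (Fin n → F) := Function.ExtendByZero.linearMap F Subtype.val
  have hι : ∀ (g : S → F) (i : S), ι g i = g i := by
    intro g i
    exact Subtype.val_injective.extend_apply g 0 i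
  have hι0 : ∀ (g : S → F) (i : Fin n), i ∉ S → ι g i = 0 := by
    intro g i hi
    exact Function.extend_apply' (f := (Subtype.val : S → Fin n)) g 0 i
      (by rintro ⟨a, rfl⟩; exact hi a.2)
  have hinj : LinearMap.ker (C.mkQ ∘ₗ ι) = ⊥ := by
    rw [LinearMap.ker_eq_bot']
    intro g hg
    have hmem : ι g ∈ C := by simpa using hg
    have h0 : ι g = 0 := by
      by_contra hne
      have h1 := hC _ hmem hne
      have h2 : hammingNorm (ι g) ≤ S.card := by
        unfold hammingNorm
        apply Finset.card_le_card
        intro i hi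
        by_contra hiS
        simp [hι0 g i hiS] at hi
      omega
    ext i
    rw [← hι g i, h0]; rfl
  obtain ⟨ρ, hρ⟩ := LinearMap.exists_leftInverse_of_injective _ hinj
  let β : (S → F) →ₗ[F] F := ∑ i : S, b i • LinearMap.proj i
  refine ⟨β ∘ₗ ρ ∘ₗ C.mkQ, ?_, ?_⟩
  · rw [Submodule.mem_dualAnnihilator]
    intro w hw
    have : C.mkQ w = 0 := by simpa using hw
    simp only [LinearMap.comp_apply, this, map_zero]
  · intro i hi
    have h1 : (Pi.single i 1 : Fin n → F) = ι (Pi.single ⟨i, hi⟩ 1) := by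
      ext j
      by_cases hj : j ∈ S
      · have := hι (Pi.single ⟨i, hi⟩ 1) ⟨j, hj⟩
        simp only at this
        rw [this]
        simp [Pi.single_apply]
      · rw [hι0 _ _ hj, Pi.single_eq_of_ne]
        rintro rfl; exact hj hi
    have h2 := LinearMap.congr_fun hρ (Pi.single ⟨i, hi⟩ 1)
    simp only [LinearMap.comp_apply, LinearMap.id_apply] at h2 ⊢
    rw [h1, h2]
    simp [β, Pi.single_apply]

lemma aux_gen {F V W : Type*} [Field F] [AddCommGroup V] [Module F V] [AddCommGroup W]
    [Module F W] [FiniteDimensional F V] (ev : V →ₗ[F] W) (hs : LinearMap.range ev = ⊤)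
    (h : Module.finrank F V = Module.finrank F W + 1) :
    ∃ w, ev w = 0 ∧ w ≠ 0 ∧ ∀ v, ev v = 0 → ∃ c : F, v = c • w := by
  have hk : Module.finrank F (LinearMap.ker ev) = 1 := by
    have := LinearMap.finrank_range_add_finrank_ker ev
    rw [hs, finrank_top] at this
    omega
  obtain ⟨w, hw, hall⟩ := finrank_eq_one_iff'.1 hk
  refine ⟨w.1, w.2, fun h => hw (Subtype.ext h), fun v hv => ?_⟩
  obtain ⟨c, hc⟩ := hall ⟨v, hv⟩
  exact ⟨c, (congr_arg Subtype.val hc).symm⟩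

lemma aux_ker {n d : ℕ} {F : Type*} [Field F] [DecidableEq F]
    (C : Submodule F (Fin n → F)) (hC : ∀ u ∈ C, u ≠ 0 → d ≤ hammingNorm u)
    (hdn : d ≤ n) (hdim : Module.finrank F C = n - d)
    (S : Finset (Fin n)) (hS : S.card + 1 = d) :
    ∃ w ∈ C.dualAnnihilator, w ≠ 0 ∧ (∀ i ∈ S, w (Pi.single i 1) = 0) ∧
      ∀ v ∈ C.dualAnnihilator, (∀ i ∈ S, v (Pi.single i 1) = 0) → ∃ c : F, v = c • w := by
  let ev : C.dualAnnihilator →ₗ[F] (S → F) :=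
    { toFun := fun w i => w.1 (Pi.single i.1 1)
      map_add' := by intros; rfl
      map_smul' := by intros; rfl }
  have hsurj : LinearMap.range ev = ⊤ := by
    rw [LinearMap.range_eq_top]
    intro g
    obtain ⟨ph, hph, hb⟩ := aux_interp C hC S (by omega) (Function.extend Subtype.val g 0)
    refine ⟨⟨ph, hph⟩, ?_⟩
    ext i
    exact (hb i i.2).trans (Subtype.val_injective.extend_apply g 0 i)
  have hA : Module.finrank F C.dualAnnihilator = d := by
    have := Subspace.finrank_add_finrank_dualAnnihilator_eq C
    simp at this
    omega
  obtain ⟨w, hw, hw0, hall⟩ := aux_gen (F := F) (V := C.dualAnnihilator) (W := S → F) ev hsurj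
    (by rw [hA]; simp; omega)
  refine ⟨w.1, w.2, ?_, ?_, ?_⟩
  · intro h; apply hw0; ext1; exact h
  · intro i hi
    exact congr_fun hw ⟨i, hi⟩
  · intro v hv hz
    obtain ⟨c, hc⟩ := hall ⟨v, hv⟩ (by ext i; exact hz i i.2)
    exact ⟨c, congr_arg Subtype.val hc⟩

lemma aux_line {ι F : Type*} [Field F] [Fintype F] [DecidableEq F]
    (u v : ι → F) (Z : Finset ι) (hZ : Z.card < Fintype.card F) (hv : ∀ j ∈ Z, v j ≠ 0) :
    ∃ c : F, ∀ j ∈ Z, u j + c * v j ≠ 0 := by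
  have hlt : (Z.image (fun j => - u j / v j)).card < (Finset.univ : Finset F).card :=
    lt_of_le_of_lt Finset.card_image_le (by simpa using hZ)
  obtain ⟨c, -, hc⟩ := Finset.exists_mem_notMem_of_card_lt_card hlt
  refine ⟨c, fun j hj h => hc ?_⟩
  rw [Finset.mem_image]
  refine ⟨j, hj, ?_⟩
  rw [div_eq_iff (hv j hj)]
  linear_combination -h

lemma aux_full {n d : ℕ} {F : Type*} [Field F] [Fintype F] [DecidableEq F]
    (C : Submodule F (Fin n → F)) (hC : ∀ u ∈ C, u ≠ 0 → d ≤ hammingNorm u)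
    (hdn : d ≤ n) (hdim : Module.finrank F C = n - d) (hd : 2 ≤ d)
    (hn : n + 2 ≤ Fintype.card F + d) :
    ∃ ph : Module.Dual F (Fin n → F), ph ∈ C.dualAnnihilator ∧
      ∀ i, ph (Pi.single i 1) ≠ 0 := by
  obtain ⟨S, -, hS⟩ := Finset.exists_subset_card_eq
    (s := (Finset.univ : Finset (Fin n))) (n := d - 1) (by simp; omega)
  obtain ⟨i, hi⟩ : S.Nonempty := by rw [← Finset.card_pos]; omega
  set T := S.erase i with hT
  have hTc : T.card + 2 = d := by rw [hT, Finset.card_erase_of_mem hi]; omega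
  have hiT : i ∉ T := by simp [hT]
  obtain ⟨w0, hw0, hw0n, hw0S, -⟩ := aux_ker C hC hdn hdim S (by omega)
  have hw0T : ∀ t ∈ T, w0 (Pi.single t 1) = 0 := fun t ht => hw0S t (Finset.mem_of_mem_erase ht)
  obtain ⟨w1, hw1, hw1S⟩ := aux_interp C hC S (by omega) (Pi.single i 1)
  have hw1i : w1 (Pi.single i 1) = 1 := by rw [hw1S i hi]; simp
  have hw1T : ∀ t ∈ T, w1 (Pi.single t 1) = 0 := by
    intro t ht
    rw [hw1S t (Finset.mem_of_mem_erase ht), Pi.single_eq_of_ne]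
    rintro rfl; exact hiT ht
  obtain ⟨w, hw, hwT⟩ := aux_interp C hC T (by omega) 1
  have hTcc : Tᶜ.card + T.card = n := by
    have := Finset.card_compl_add_card T
    simpa using this
  obtain ⟨k, hk⟩ : ∃ k, w0 (Pi.single k 1) ≠ 0 := by
    by_contra! h
    apply hw0n
    ext k
    simpa using h k
  have hkT : k ∈ Tᶜ := by
    rw [Finset.mem_compl]; intro h; exact hk (hw0T k h)
  have hsplit := Finset.card_filter_add_card_filter_not (s := Tᶜ)
    (fun j => w0 (Pi.single j 1) = 0)
  set Z := Tᶜ.filter (fun j => w0 (Pi.single j 1) = 0) with hZ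
  set Y := Tᶜ.filter (fun j => ¬ w0 (Pi.single j 1) = 0) with hY
  have hZ1 : 0 < Z.card := Finset.card_pos.2 ⟨i, by simp [hZ, hiT, hw0S i hi]⟩
  have hY1 : 0 < Y.card := Finset.card_pos.2 ⟨k, by rw [hY, Finset.mem_filter]; exact ⟨hkT, hk⟩⟩
  obtain ⟨c, hc⟩ := aux_line (fun j => w (Pi.single j 1)) (fun j => w1 (Pi.single j 1)) Z
    (by omega) (by
      intro j hj h
      rw [hZ, Finset.mem_filter, Finset.mem_compl] at hj
      obtain ⟨hjT, hj0⟩ := hj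
      obtain ⟨x, -, -, -, hx⟩ := aux_ker C hC hdn hdim (insert j T)
        (by rw [Finset.card_insert_of_notMem hjT]; omega)
      obtain ⟨a, ha⟩ := hx w0 hw0 (by
        intro t ht
        rcases Finset.mem_insert.1 ht with rfl | ht
        · exact hj0
        · exact hw0T t ht)
      obtain ⟨a', ha'⟩ := hx w1 hw1 (by
        intro t ht
        rcases Finset.mem_insert.1 ht with rfl | ht
        · exact h
        · exact hw1T t ht)
      have ha0 : a ≠ 0 := by rintro rfl; apply hw0n; rw [ha]; simp
      have h3 := hw0S i hi
      rw [ha] at h3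
      have h4 : x (Pi.single i 1) = 0 := by
        simpa [ha0] using h3
      rw [ha'] at hw1i
      simp [h4] at hw1i)
  obtain ⟨t, ht⟩ := aux_line (fun j => (w + c • w1) (Pi.single j 1))
    (fun j => w0 (Pi.single j 1)) Y (by omega) (by
      intro j hj; rw [hY, Finset.mem_filter] at hj; exact hj.2)
  refine ⟨w + c • w1 + t • w0, ?_, ?_⟩
  · exact add_mem (add_mem hw (Submodule.smul_mem _ _ hw1)) (Submodule.smul_mem _ _ hw0)
  · intro j
    by_cases hjT : j ∈ T
    · simp [hwT j hjT, hw1T j hjT, hw0T j hjT]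
    · by_cases hj0 : w0 (Pi.single j 1) = 0
      · have := hc j (by simp [hZ, hjT, hj0])
        simpa [hj0] using this
      · have := ht j (by simp [hY, hjT, hj0])
        simpa using this

/-- The label of a permutation: for each fibre `{k, k+q}`, the order of the two positions. -/
def lab {n q : ℕ} (hn : n ≤ 2 * q) (σ : Equiv.Perm (Fin n)) (k : Fin (n - q)) : ZMod 2 :=
  if σ.symm ⟨k, by omega⟩ < σ.symm ⟨k + q, by omega⟩ then 0 else 1

lemma mod_cases {n q a b : ℕ} (hn : n ≤ 2 * q) (ha : a < n) (hb : b < n)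
    (h : a % q = b % q) : a = b ∨ a = b + q ∨ b = a + q := by
  have h1 : a / q < 2 := Nat.div_lt_of_lt_mul (by omega)
  have h2 : b / q < 2 := Nat.div_lt_of_lt_mul (by omega)
  have h3 := Nat.div_add_mod a q
  have h4 := Nat.div_add_mod b q
  interval_cases ha' : a / q <;> interval_cases hb' : b / q <;> simp at h3 h4 <;> omega

lemma aux_swap {n q : ℕ} (hn : n ≤ 2 * q) (σ τ : Equiv.Perm (Fin n))
    (h : ∀ i, (σ i : ℕ) % q = (τ i : ℕ) % q) (i : Fin n) (k : Fin (n - q))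
    (h1 : (σ i : ℕ) = k) (h2 : (τ i : ℕ) = k + q) : lab hn σ k ≠ lab hn τ k := by
  set a : Fin n := ⟨k, by omega⟩ with ha
  set b : Fin n := ⟨k + q, by omega⟩ with hb
  have hq : 0 < q := by have := k.2; omega
  have e1 : σ i = a := Fin.ext h1
  have e2 : τ i = b := Fin.ext h2
  have s1 : σ.symm a = i := by rw [← e1]; simp
  have s2 : τ.symm b = i := by rw [← e2]; simp
  set j := τ.symm a with hj
  have hτj : τ j = a := by simp [hj]
  have hne : j ≠ i := by
    intro hh
    rw [hh, e2] at hτj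
    have := congr_arg Fin.val hτj
    simp [ha, hb] at this
    omega
  have hσj : σ j = b := by
    have h3 := mod_cases hn (σ j).2 (τ j).2 (h j)
    rw [hτj] at h3
    have hne' : (σ j : ℕ) ≠ a := by
      intro hh
      exact hne (σ.injective (by rw [e1]; exact Fin.ext hh))
    apply Fin.ext
    have : (a : ℕ) = k := rfl
    have : (b : ℕ) = k + q := rfl
    have := k.2
    have := (σ j).2
    omega
  have s3 : σ.symm b = j := by rw [← hσj]; simp
  unfold lab
  rw [← ha, ← hb, s1, s2, s3, ← hj]
  rcases lt_or_gt_of_ne hne with hl | hl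
  · rw [if_neg (not_lt.2 hl.le), if_pos hl]; decide
  · rw [if_pos hl, if_neg (not_lt.2 hl.le)]; decide

lemma aux_lab_ne {n q : ℕ} (hn : n ≤ 2 * q) (σ τ : Equiv.Perm (Fin n))
    (h : ∀ i, (σ i : ℕ) % q = (τ i : ℕ) % q) (hne : σ ≠ τ) : lab hn σ ≠ lab hn τ := by
  obtain ⟨i, hi⟩ : ∃ i, σ i ≠ τ i := by
    by_contra! hh; exact hne (Equiv.ext hh)
  have hi' : (σ i : ℕ) ≠ τ i := fun hh => hi (Fin.ext hh)
  have b1 := (σ i).2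
  have b2 := (τ i).2
  rcases mod_cases hn b1 b2 (h i) with h1 | h1 | h1
  · exact absurd h1 hi'
  · intro hl
    exact aux_swap hn τ σ (fun i => (h i).symm) i ⟨τ i, by omega⟩ rfl h1
      (congr_fun hl.symm _)
  · intro hl
    exact aux_swap hn σ τ h i ⟨σ i, by omega⟩ rfl h1 (congr_fun hl _)

lemma aux_lab_dist {n q : ℕ} (hn : n ≤ 2 * q) (σ τ : Equiv.Perm (Fin n))
    (h : ∀ i, (σ i : ℕ) % q = (τ i : ℕ) % q) :
    2 * hammingDist (lab hn σ) (lab hn τ) ≤ permDist σ τ := by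
  have key : ∀ k : Fin (n - q), lab hn σ k ≠ lab hn τ k →
      σ.symm ⟨k, by omega⟩ ≠ τ.symm ⟨k, by omega⟩ ∧
      σ.symm ⟨k + q, by omega⟩ ≠ τ.symm ⟨k + q, by omega⟩ := by
    intro k hk
    have hq : 0 < q := by have := k.2; omega
    have hkq := k.2
    set a : Fin n := ⟨k, by omega⟩ with ha
    set b : Fin n := ⟨k + q, by omega⟩ with hb
    have hav : (a : ℕ) = k := rfl
    have hbv : (b : ℕ) = k + q := rfl
    have hab : a ≠ b := by
      intro hh; have := congr_arg Fin.val hh; omega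
    -- if one of the two points has the same position, then so has the other one
    have gen : ∀ x y : Fin n, (x = a ∧ y = b ∨ x = b ∧ y = a) →
        σ.symm x = τ.symm x → σ.symm y = τ.symm y := by
      intro x y hxy hx
      set j := τ.symm y with hj
      have hτj : τ j = y := by simp [hj]
      have h3 := mod_cases hn (σ j).2 (τ j).2 (h j)
      rw [hτj] at h3
      have hnx : σ j ≠ x := by
        intro hh
        have : σ.symm x = j := by rw [← hh]; simp
        rw [hx, hj] at this
        have := τ.symm.injective this
        rcases hxy with ⟨r1, r2⟩ | ⟨r1, r2⟩
        · exact hab (by rw [← r1, ← r2, this])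
        · exact hab (by rw [← r1, ← r2, this])
      have hnx' : (σ j : ℕ) ≠ x := fun hh => hnx (Fin.ext hh)
      have : σ j = y := by
        apply Fin.ext
        have := (σ j).2
        rcases hxy with ⟨r1, r2⟩ | ⟨r1, r2⟩ <;> rw [r1] at hnx' <;> rw [r2] at h3 ⊢ <;> omega
      rw [← this]; simp
    have fin : ¬ (σ.symm a = τ.symm a ∧ σ.symm b = τ.symm b) := by
      rintro ⟨r1, r2⟩
      apply hk
      unfold lab
      rw [← ha, ← hb, r1, r2]
    constructor
    · intro hh; exact fin ⟨hh, gen a b (Or.inl ⟨rfl, rfl⟩) hh⟩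
    · intro hh; exact fin ⟨gen b a (Or.inr ⟨rfl, rfl⟩) hh, hh⟩
  have hcard : 2 * hammingDist (lab hn σ) (lab hn τ) =
      ((Finset.univ.filter (fun k => lab hn σ k ≠ lab hn τ k)) ×ˢ
        (Finset.univ : Finset Bool)).card := by
    rw [Finset.card_product]; simp [hammingDist, mul_comm]
  rw [hcard]
  unfold permDist hammingDist
  let g : Fin (n - q) × Bool → Fin n := fun p =>
    if p.2 then σ.symm ⟨p.1 + q, by omega⟩ else σ.symm ⟨p.1, by omega⟩
  apply Finset.card_le_card_of_injOn g
  · rintro ⟨k, bb⟩ hp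
    simp only [Finset.coe_product, Set.mem_prod, Finset.mem_coe, Finset.mem_filter,
      Finset.mem_univ, true_and, and_true] at hp
    obtain ⟨k1, k2⟩ := key k hp
    simp only [Finset.coe_filter, Finset.mem_univ, true_and, Set.mem_setOf_eq]
    cases bb
    · simp only [g]
      intro hh
      apply k1
      simp only [Bool.false_eq_true, if_false, Equiv.apply_symm_apply] at hh
      rw [Equiv.eq_symm_apply]; exact hh.symm
    · simp only [g]
      intro hh
      apply k2
      simp only [if_true, Equiv.apply_symm_apply] at hh
      rw [Equiv.eq_symm_apply]; exact hh.symm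
  · rintro ⟨k, bb⟩ - ⟨k', bb'⟩ - hp
    have := k.2
    have := k'.2
    cases bb <;> cases bb' <;> simp [g, Fin.ext_iff] at hp ⊢ <;> omega

lemma A2_attained (r e : ℕ) : ∃ B : Finset (Fin r → ZMod 2), B.card = A2 r e ∧
    ∀ u ∈ B, ∀ v ∈ B, u ≠ v → e ≤ hammingDist u v := by
  have := Nat.sSup_mem (s := {m | ∃ C : Finset (Fin r → ZMod 2), C.card = m ∧
    ∀ u ∈ C, ∀ v ∈ C, u ≠ v → e ≤ hammingDist u v}) ⟨0, ∅, by simp⟩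
    ⟨Fintype.card (Fin r → ZMod 2), by
      rintro m ⟨D, rfl, -⟩; exact Finset.card_le_univ D⟩
  exact this

/-- Theorem 5.6: if an `[n,n-d,d]_q` AMDS code exists, with `d ≥ 2` and
`q < n ≤ min(2q, q+d-2)`, then there is a permutation code in `S_n` of minimum distance
at least `d` and size at least `n!·A_2(n-q,⌈d/2⌉)/(2^(n-q)·q^(d-1))`. -/
theorem perm_code_lower_bound_AMDS'
    (n d q : ℕ) (hn : 0 < n) (hd : 2 ≤ d) (hq : IsPrimePow q)
    (hqn : q < n) (hn2q : n ≤ min (2 * q) (q + d - 2))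
    (F : Type*) [Field F] [Fintype F] [DecidableEq F] (hF : Fintype.card F = q)
    (C : Submodule F (Fin n → F)) (hdim : Module.finrank F C = n - d)
    (hmind : minDist C = d) :
    ∃ Γ : Finset (Equiv.Perm (Fin n)),
      (∀ σ ∈ Γ, ∀ τ ∈ Γ, σ ≠ τ → d ≤ permDist σ τ) ∧
      (n ! : ℝ) * (A2 (n - q) ((d + 1) / 2) : ℝ) /
          (2 ^ (n - q) * (q : ℝ) ^ (d - 1)) ≤ Γ.card := by
  classical
  have hC : ∀ u ∈ C, u ≠ 0 → d ≤ hammingNorm u := by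
    intro u hu hu0
    rw [← hmind]
    exact Nat.sInf_le ⟨u, hu, hu0, rfl⟩
  have hdn : d < n := by
    by_contra hlt
    have h0 : Module.finrank F C = 0 := by omega
    rw [Submodule.finrank_eq_zero] at h0
    have : minDist C = 0 := by
      unfold minDist
      rw [Nat.sInf_eq_zero]
      right
      rw [Set.eq_empty_iff_forall_notMem]
      rintro w ⟨u, hu, hu0, -⟩
      rw [h0, Submodule.mem_bot] at hu
      exact hu0 hu
    omega
  have hnq : n ≤ 2 * q := le_trans hn2q (min_le_left _ _)
  have hnd : n ≤ q + d - 2 := le_trans hn2q (min_le_right _ _)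
  have hq0 : 0 < q := hq.pos
  obtain ⟨ph, hphC, hph⟩ := aux_full C hC hdn.le hdim hd (by omega)
  obtain ⟨B, hBc, hB⟩ := A2_attained (n - q) ((d + 1) / 2)
  let e : F ≃ Fin q := Fintype.equivFinOfCardEq hF
  let f : Fin n → F := fun i => e.symm ⟨i % q, Nat.mod_lt _ hq0⟩
  have hf : ∀ i j : Fin n, f i = f j → (i : ℕ) % q = (j : ℕ) % q := by
    intro i j hij
    have := e.symm.injective hij
    simpa using this
  let x : Equiv.Perm (Fin n) → Fin n → F := fun σ i => (ph (Pi.single i 1))⁻¹ * f (σ i)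
  have hphx : ∀ y : Fin n → F, ph y = ∑ i, y i * ph (Pi.single i 1) := by
    intro y
    rw [LinearMap.pi_apply_eq_sum_univ ph y]
    apply Finset.sum_congr rfl
    intro i _
    rw [smul_eq_mul]
    congr 2
    ext j
    simp [Pi.single_apply, eq_comm]
  have hsum : ∀ σ, ph (x σ) = ∑ i, f i := by
    intro σ
    rw [hphx, ← Equiv.sum_comp σ f]
    apply Finset.sum_congr rfl
    intro i _
    simp only [x]
    field_simp [hph i]
  -- cosets met by the words lie in a translate of the hyperplane `H`
  let ps : ((Fin n → F) ⧸ C) →ₗ[F] F := C.liftQ ph (by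
    intro c hc
    rw [LinearMap.mem_ker]
    exact (Submodule.mem_dualAnnihilator ph).1 hphC c hc)
  have hps : ∀ y, ps (C.mkQ y) = ph y := fun y => C.liftQ_apply ph y
  have hrange : LinearMap.range ps = ⊤ := by
    apply LinearMap.range_eq_top.2
    apply LinearMap.surjective_of_ne_zero
    intro h0
    apply hph ⟨0, hn⟩
    rw [← hps, h0]; rfl
  have hV : Module.finrank F ((Fin n → F) ⧸ C) = d := by
    have := C.finrank_quotient_add_finrank
    simp at this
    omega
  have hH : Nat.card (LinearMap.ker ps) = q ^ (d - 1) := by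
    have := LinearMap.finrank_range_add_finrank_ker ps
    rw [hrange, hV] at this
    simp at this
    rw [Module.natCard_eq_pow_finrank (K := F), Nat.card_eq_fintype_card, hF]
    congr 1
    omega
  let o : (Fin n → F) ⧸ C := C.mkQ (x 1)
  let cl : Equiv.Perm (Fin n) → LinearMap.ker ps := fun σ => ⟨C.mkQ (x σ) - o, by
    rw [LinearMap.mem_ker, map_sub, hps, hps, hsum, hsum, sub_self]⟩
  haveI : Fintype (LinearMap.ker ps) := Fintype.ofFinite _
  let G : LinearMap.ker ps × (Fin (n - q) → ZMod 2) → Finset (Equiv.Perm (Fin n)) := fun p =>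
    Finset.univ.filter (fun σ => cl σ = p.1 ∧ lab hnq σ - p.2 ∈ B)
  have htot : ∑ p, (G p).card = n ! * B.card := by
    have h1 : ∀ p, (G p).card = ∑ σ : Equiv.Perm (Fin n),
        if cl σ = p.1 ∧ lab hnq σ - p.2 ∈ B then 1 else 0 := by
      intro p; rw [Finset.card_filter]
    simp_rw [h1]
    rw [Finset.sum_comm]
    have h2 : ∀ σ : Equiv.Perm (Fin n), (∑ p : LinearMap.ker ps × (Fin (n - q) → ZMod 2),
        if cl σ = p.1 ∧ lab hnq σ - p.2 ∈ B then 1 else 0) = B.card := by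
      intro σ
      rw [← Finset.card_filter]
      symm
      apply Finset.card_bij (fun b _ => (cl σ, lab hnq σ - b))
      · intro b hb; simp [hb]
      · intro b _ b' _ h
        simpa using h
      · rintro ⟨v, w⟩ h
        simp only [Finset.mem_filter, Finset.mem_univ, true_and] at h
        exact ⟨lab hnq σ - w, h.2, by simp [h.1]⟩
    simp_rw [h2]
    simp [Fintype.card_perm]
  have hcardP : Fintype.card (LinearMap.ker ps × (Fin (n - q) → ZMod 2))
      = q ^ (d - 1) * 2 ^ (n - q) := by
    rw [Fintype.card_prod, ← Nat.card_eq_fintype_card (α := LinearMap.ker ps), hH]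
    simp
  obtain ⟨p, hp⟩ : ∃ p, n ! * B.card ≤ q ^ (d - 1) * 2 ^ (n - q) * (G p).card := by
    by_contra! hlt
    have : ∑ p, q ^ (d - 1) * 2 ^ (n - q) * (G p).card <
        ∑ p : LinearMap.ker ps × (Fin (n - q) → ZMod 2), n ! * B.card :=
      Finset.sum_lt_sum_of_nonempty ⟨0, Finset.mem_univ _⟩ (fun p _ => hlt p)
    rw [← Finset.mul_sum, htot, Finset.sum_const, Finset.card_univ, hcardP, smul_eq_mul] at this
    exact lt_irrefl _ this
  refine ⟨G p, ?_, ?_⟩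
  · intro σ hσ τ hτ hne
    simp only [G, Finset.mem_filter, Finset.mem_univ, true_and] at hσ hτ
    by_cases hx : x σ = x τ
    · have hmod : ∀ i, (σ i : ℕ) % q = (τ i : ℕ) % q := by
        intro i
        apply hf
        have := congr_fun hx i
        exact mul_left_cancel₀ (inv_ne_zero (hph i)) this
      have h1 := aux_lab_ne hnq σ τ hmod hne
      have h2 := aux_lab_dist hnq σ τ hmod
      have h3 := hB _ hσ.2 _ hτ.2 (fun h => h1 (sub_left_injective h))
      have h4 : hammingDist (lab hnq σ - p.2) (lab hnq τ - p.2)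
          = hammingDist (lab hnq σ) (lab hnq τ) := by
        simp [hammingDist]
      omega
    · have hmem : x σ - x τ ∈ C := by
        have h1 : cl σ = cl τ := by rw [hσ.1, hτ.1]
        have h2 : C.mkQ (x σ) - o = C.mkQ (x τ) - o := congr_arg Subtype.val h1
        have h3 := sub_left_injective h2
        exact (Submodule.Quotient.eq C).1 h3
      have h1 := hC _ hmem (sub_ne_zero.2 hx)
      refine le_trans h1 ?_
      unfold hammingNorm permDist hammingDist
      apply Finset.card_le_card
      intro i hi
      simp only [Finset.mem_filter, Finset.mem_univ, true_and] at hi ⊢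
      intro hh
      apply hi
      simp [x, hh]
  · rw [← hBc, div_le_iff₀ (by positivity)]
    have : ((n ! * B.card : ℕ) : ℝ) ≤ ((q ^ (d - 1) * 2 ^ (n - q) * (G p).card : ℕ) : ℝ) := by
      exact_mod_cast hp
    push_cast at this
    linarith
end

section
/- Let α and b be real numbers with 1 < α ≤ 2 and (α−1)/(α·log₂ α) < b < 1. Let q be a prime power, let n and d be positive integers with n = α·q, d = b·n, and ⌈d/2⌉ ≤ n − q, and let p be the smallest prime number greater than or equal to n. Then (n!·A_2(n−q, ⌈d/2⌉)/(2^{n−q}·q^{d−1})) / (n!/p^{d−2}) ≥ (2/(α²·q)) · 2^{(α·log₂(α)·b − α + 1)·q}. -/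
open Nat

theorem A2_ge_two (r e : ℕ) (hr : 0 < r) (he : e ≤ r) : 2 ≤ A2 r e := by
  unfold A2
  apply le_csSup
  · refine ⟨Fintype.card (Fin r → ZMod 2), ?_⟩
    rintro m ⟨C, rfl, -⟩
    exact Finset.card_le_univ C
  · have hne : (fun _ => 0 : Fin r → ZMod 2) ≠ (fun _ => 1) := by
      intro h
      have := congrFun h ⟨0, hr⟩
      simp at this
    have hd : hammingDist (fun _ => 0 : Fin r → ZMod 2) (fun _ => 1) = r := by
      simp [hammingDist]
    refine ⟨{(fun _ => 0), (fun _ => 1)}, Finset.card_pair hne, ?_⟩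
    intro u hu v hv huv
    simp only [Finset.mem_insert, Finset.mem_singleton] at hu hv
    rcases hu with rfl | rfl <;> rcases hv with rfl | rfl
    · exact absurd rfl huv
    · rw [hd]; exact he
    · rw [hammingDist_comm, hd]; exact he
    · exact absurd rfl huv

/-- Proposition 6.3 (key inequality): in the regime `n = α·q`, `d = b·n` with
`1 < α ≤ 2` and `(α-1)/(α·log₂ α) < b < 1`, the ratio `B_amds(n,d)/B_old(n,d)` is at
least `(2/(α²·q))·2^((α·log₂(α)·b - α + 1)·q)`. -/
theorem ratio_amds_old_ge
    (α b : ℝ) (hα1 : 1 < α) (hα2 : α ≤ 2)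
    (hb1 : (α - 1) / (α * Real.logb 2 α) < b) (hb2 : b < 1)
    (q n d : ℕ) (hq : IsPrimePow q) (hn : 0 < n) (hd : 0 < d)
    (hnq : (n : ℝ) = α * q) (hdn : (d : ℝ) = b * n)
    (hdq : (d + 1) / 2 ≤ n - q) :
    (2 / (α ^ 2 * q)) * (2 : ℝ) ^ ((α * Real.logb 2 α * b - α + 1) * (q : ℝ)) ≤
      ((n ! : ℝ) * (A2 (n - q) ((d + 1) / 2) : ℝ) / (2 ^ (n - q) * (q : ℝ) ^ (d - 1))) /
        ((n ! : ℝ) / ((sInf {p : ℕ | p.Prime ∧ n ≤ p} : ℕ) : ℝ) ^ (d - 2)) := by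
  have hq0 : 0 < q := hq.pos
  have hqR : (0 : ℝ) < q := by exact_mod_cast hq0
  have hα0 : 0 < α := by linarith
  have hlt : q < n := by
    have : (q : ℝ) < n := by rw [hnq]; nlinarith
    exact_mod_cast this
  have hA : (2 : ℝ) ≤ (A2 (n - q) ((d + 1) / 2) : ℝ) := by
    exact_mod_cast A2_ge_two (n - q) ((d + 1) / 2) (by omega) hdq
  have hp : n ≤ sInf {p : ℕ | p.Prime ∧ n ≤ p} := by
    obtain ⟨p, hp1, hp2⟩ := Nat.exists_infinite_primes n
    exact (Nat.sInf_mem (s := {p : ℕ | p.Prime ∧ n ≤ p}) ⟨p, hp2, hp1⟩).2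
  generalize sInf {p : ℕ | p.Prime ∧ n ≤ p} = p at hp ⊢
  generalize (A2 (n - q) ((d + 1) / 2) : ℝ) = A at hA ⊢
  have hpR : α * q ≤ (p : ℝ) := by rw [← hnq]; exact_mod_cast hp
  have hp0 : (0 : ℝ) < p := lt_of_lt_of_le (by positivity) hpR
  have hexp : (2 : ℝ) ^ ((α * Real.logb 2 α * b - α + 1) * (q : ℝ))
      = α ^ d / 2 ^ (n - q) := by
    have h1 : (α * Real.logb 2 α * b - α + 1) * (q : ℝ)
        = Real.logb 2 α * (d : ℝ) - ((n - q : ℕ) : ℝ) := by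
      rw [Nat.cast_sub hlt.le, hdn, hnq]; ring
    rw [h1, Real.rpow_sub (by norm_num), Real.rpow_mul (by norm_num),
      Real.rpow_logb (by norm_num) (by norm_num) hα0, Real.rpow_natCast, Real.rpow_natCast]
  have hkey : α ^ d / (α ^ 2 * q) ≤ (p : ℝ) ^ (d - 2) / (q : ℝ) ^ (d - 1) := by
    rcases Nat.lt_or_ge d 2 with h | h
    · have : d = 1 := by omega
      subst this
      have h1 : (1 : ℝ) ≤ q := by exact_mod_cast hq0
      rw [div_le_div_iff₀ (by positivity) (by positivity)]
      norm_num
      nlinarith [mul_pos hα0 hα0, mul_le_mul_of_nonneg_left h1 (sq_nonneg α)]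
    · obtain ⟨k, rfl⟩ := Nat.exists_eq_add_of_le h
      have e1 : 2 + k - 2 = k := by omega
      have e2 : 2 + k - 1 = k + 1 := by omega
      rw [e1, e2]
      have h3 : (α * q) ^ k ≤ (p : ℝ) ^ k := pow_le_pow_left₀ (by positivity) hpR k
      have h4 : α ^ (2 + k) / (α ^ 2 * q) = (α * q) ^ k / (q : ℝ) ^ (k + 1) := by
        rw [mul_pow, pow_add, pow_succ (q : ℝ) k]
        field_simp
      rw [h4]
      gcongr
  have hf : (0 : ℝ) < (n ! : ℝ) := by exact_mod_cast Nat.factorial_pos n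
  rw [hexp]
  calc (2 / (α ^ 2 * q)) * (α ^ d / 2 ^ (n - q))
      = 2 / 2 ^ (n - q) * (α ^ d / (α ^ 2 * q)) := by ring
    _ ≤ A / 2 ^ (n - q) * ((p : ℝ) ^ (d - 2) / (q : ℝ) ^ (d - 1)) := by gcongr
    _ = _ := by field_simp
end

section
/- Let α and b be real numbers with 1 < α ≤ 2 and (α−1)/(α·log₂ α) < b < 1. Then for every real M there exists Q such that for every prime power q ≥ Q and all positive integers n, d with n = α·q, d = b·n, and ⌈d/2⌉ ≤ n − q, one has (n!·A_2(n−q, ⌈d/2⌉)/(2^{n−q}·q^{d−1})) / (n!/p^{d−2}) > M, where p denotes the smallest prime number greater than or equal to n. That is, the ratio B_amds(n,d)/B_old(n,d) tends to +∞ as q → ∞ in this regime. -/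
open Nat

theorem A2_pos (r e : ℕ) : 1 ≤ A2 r e := by
  unfold A2
  apply le_csSup
  · refine ⟨Fintype.card (Fin r → ZMod 2), ?_⟩
    rintro m ⟨C, rfl, -⟩
    exact Finset.card_le_univ C
  · refine ⟨{0}, by simp, ?_⟩
    intro u hu v hv huv
    simp at hu hv
    exact absurd (hu.trans hv.symm) huv

/-- Proposition 6.3: in the regime `n = α·q`, `d = b·n` with `1 < α ≤ 2` and
`(α-1)/(α·log₂ α) < b < 1`, the ratio `B_amds(n,d)/B_old(n,d)` tends to `+∞`
as the prime power `q` goes to infinity. -/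
theorem ratio_amds_old_tendsto_atTop
    (α b : ℝ) (hα1 : 1 < α) (hα2 : α ≤ 2)
    (hb1 : (α - 1) / (α * Real.logb 2 α) < b) (hb2 : b < 1) :
    ∀ M : ℝ, ∃ Q : ℕ, ∀ q : ℕ, IsPrimePow q → Q ≤ q →
      ∀ n d : ℕ, 0 < n → 0 < d → (n : ℝ) = α * q → (d : ℝ) = b * n →
        (d + 1) / 2 ≤ n - q →
        M < ((n ! : ℝ) * (A2 (n - q) ((d + 1) / 2) : ℝ) /
              (2 ^ (n - q) * (q : ℝ) ^ (d - 1))) /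
            ((n ! : ℝ) / ((sInf {p : ℕ | p.Prime ∧ n ≤ p} : ℕ) : ℝ) ^ (d - 2)) := by
  intro M
  have hla : 0 < Real.log α := Real.log_pos hα1
  have hl2 : 0 < Real.log 2 := Real.log_pos (by norm_num)
  have hα0 : 0 < α := by linarith
  obtain ⟨c, hc⟩ : ∃ c, c = b * α * Real.log α - (α - 1) * Real.log 2 := ⟨_, rfl⟩
  have hc0 : 0 < c := by
    unfold Real.logb at hb1
    rw [div_lt_iff₀ (by positivity)] at hb1
    have h := mul_lt_mul_of_pos_right hb1 hl2
    have h2 : b * (α * (Real.log α / Real.log 2)) * Real.log 2 = b * α * Real.log α := by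
      field_simp
    rw [h2] at h
    linarith
  obtain ⟨K, hK⟩ : ∃ K : ℝ, K = |M| + 1 := ⟨_, rfl⟩
  have hK0 : 0 < K := by rw [hK]; positivity
  have hMK : M < K := by rw [hK]; linarith [le_abs_self M]
  obtain ⟨Q, hQ⟩ := exists_nat_gt (2 * K * α ^ 2 / c ^ 2)
  refine ⟨Q, ?_⟩
  intro q hq hQq n d hn hd hnq hdn _
  have hq1 : 1 ≤ q := hq.one_lt.le
  have hq0 : (0 : ℝ) < q := by exact_mod_cast hq1
  have hq1r : (1 : ℝ) ≤ q := by exact_mod_cast hq1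
  have hqn : q ≤ n := by
    have : (q : ℝ) ≤ n := by rw [hnq]; nlinarith
    exact_mod_cast this
  obtain ⟨p, hp⟩ : ∃ p, p = sInf {p : ℕ | p.Prime ∧ n ≤ p} := ⟨_, rfl⟩
  have hpn : n ≤ p := by
    have h : sInf {p : ℕ | p.Prime ∧ n ≤ p} ∈ {p : ℕ | p.Prime ∧ n ≤ p} := by
      apply Nat.sInf_mem
      obtain ⟨p, h1, h2⟩ := Nat.exists_infinite_primes n
      exact ⟨p, h2, h1⟩
    rw [hp]; exact h.2
  rw [← hp]
  have hnr : (0 : ℝ) < n := by exact_mod_cast hn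
  have hpr : (n : ℝ) ≤ p := by exact_mod_cast hpn
  have hp0 : (0 : ℝ) < p := by linarith
  have hA : (1 : ℝ) ≤ (A2 (n - q) ((d + 1) / 2) : ℝ) := by exact_mod_cast A2_pos _ _
  have hf : (0 : ℝ) < (n ! : ℝ) := by exact_mod_cast Nat.factorial_pos n
  -- the exponential estimate
  have hexp : K * α ^ 2 * q < Real.exp (c * q) := by
    have h1 := Real.quadratic_le_exp_of_nonneg (show 0 ≤ c * q by positivity)
    have h2 : 2 * K * α ^ 2 / c ^ 2 < q := hQ.trans_le (by exact_mod_cast hQq)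
    rw [div_lt_iff₀ (by positivity)] at h2
    have h3 := mul_lt_mul_of_pos_right h2 hq0
    have h4 : 0 < c * q := by positivity
    nlinarith
  have hpow2 : (2 : ℝ) ^ (n - q) = Real.exp ((α - 1) * Real.log 2 * q) := by
    rw [← Real.exp_log (show (0 : ℝ) < 2 ^ (n - q) by positivity), Real.log_pow,
      Nat.cast_sub hqn, hnq]
    congr 1; ring
  have hpowa : α ^ d = Real.exp (b * α * Real.log α * q) := by
    rw [← Real.exp_log (show (0 : ℝ) < α ^ d by positivity), Real.log_pow, hdn, hnq]
    congr 1; ring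
  have hmain : K * α ^ 2 * q * 2 ^ (n - q) < α ^ d := by
    have : α ^ d = Real.exp (c * q) * 2 ^ (n - q) := by
      rw [hpow2, hpowa, ← Real.exp_add, hc]; congr 1; ring
    rw [this]
    exact mul_lt_mul_of_pos_right hexp (by positivity)
  have hd1 : α ^ d ≤ α ^ (d - 2) * α ^ 2 := by
    rw [← pow_add]; exact pow_le_pow_right₀ hα1.le (by omega)
  have hmain2 : K * q * 2 ^ (n - q) < α ^ (d - 2) := by
    have : 0 < α ^ 2 := by positivity
    by_contra! h
    have := mul_le_mul_of_nonneg_right h this.le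
    linarith
  have hq2 : (q : ℝ) ^ (d - 1) ≤ (q : ℝ) ^ (d - 2) * q := by
    rw [← pow_succ]; exact pow_le_pow_right₀ hq1r (by omega)
  have hpp : α ^ (d - 2) * (q : ℝ) ^ (d - 2) ≤ (p : ℝ) ^ (d - 2) := by
    rw [← mul_pow, ← hnq]; exact pow_le_pow_left₀ hnr.le hpr _
  have heq : ((n ! : ℝ) * (A2 (n - q) ((d + 1) / 2) : ℝ) /
              (2 ^ (n - q) * (q : ℝ) ^ (d - 1))) / ((n ! : ℝ) / (p : ℝ) ^ (d - 2))
      = (A2 (n - q) ((d + 1) / 2) : ℝ) * (p : ℝ) ^ (d - 2) /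
        (2 ^ (n - q) * (q : ℝ) ^ (d - 1)) := by
    field_simp
  rw [heq]
  refine hMK.trans ?_
  rw [lt_div_iff₀ (by positivity)]
  calc K * (2 ^ (n - q) * (q : ℝ) ^ (d - 1))
      ≤ K * (2 ^ (n - q) * ((q : ℝ) ^ (d - 2) * q)) := by gcongr
    _ = (K * q * 2 ^ (n - q)) * (q : ℝ) ^ (d - 2) := by ring
    _ < α ^ (d - 2) * (q : ℝ) ^ (d - 2) := mul_lt_mul_of_pos_right hmain2 (by positivity)
    _ ≤ (p : ℝ) ^ (d - 2) := hpp
    _ ≤ _ := le_mul_of_one_le_left (by positivity) hA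
end

section
/- Let α and b be real numbers with 1 < α ≤ 2 and 0 < b < 1. Then for every real M there exists Q such that for every prime power q ≥ Q and all positive integers n, d with n = α·q and 1 ≤ d ≤ b·n, one has n! / (2^{n−q−1} · q^{d−1}) > M. (In particular, in this regime the AMDS bound B_amds(n,d) ≥ 2·n!/(2^{n−q} q^{d−1}) is asymptotically non-trivial, i.e., it tends to +∞.) -/
open Nat

/-- Remark after Proposition 6.3: in the regime `n = α·q`, `d ≤ b·n` with `1 < α ≤ 2`
and `0 < b < 1`, the quantity `n!/(2^(n-q-1)·q^(d-1))`, a lower bound for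
`B_amds(n,d)`, tends to `+∞` as the prime power `q` goes to infinity. -/
theorem B_amds_lower_tendsto_atTop
    (α b : ℝ) (hα1 : 1 < α) (hα2 : α ≤ 2) (hb0 : 0 < b) (hb1 : b < 1) :
    ∀ M : ℝ, ∃ Q : ℕ, ∀ q : ℕ, IsPrimePow q → Q ≤ q →
      ∀ n d : ℕ, 0 < n → 1 ≤ d → (n : ℝ) = α * q → (d : ℝ) ≤ b * n →
        M < (n ! : ℝ) / (2 ^ (n - q - 1) * (q : ℝ) ^ (d - 1)) := by
  intro M
  obtain ⟨K, hK⟩ := Filter.eventually_atTop.1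
    ((tendsto_rpow_atTop (sub_pos.2 hb1)).eventually_ge_atTop (12 : ℝ))
  obtain ⟨Q, hQ⟩ := exists_nat_ge (max K M)
  refine ⟨Q, fun q hq hQq n d hn hd hnq hdn => ?_⟩
  have hq0 : (0 : ℝ) < q := by exact_mod_cast hq.pos
  have hn0 : (0 : ℝ) < n := by exact_mod_cast hn
  have hn1 : (1 : ℝ) ≤ n := by exact_mod_cast hn
  have hqn : (q : ℝ) ≤ n := by rw [hnq]; nlinarith
  have hQq' : (Q : ℝ) ≤ q := by exact_mod_cast hQq
  have hKn : K ≤ n := (le_max_left K M).trans (hQ.trans (hQq'.trans hqn))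
  have hMn : M ≤ n := (le_max_right K M).trans (hQ.trans (hQq'.trans hqn))
  have h12 : (12 : ℝ) ≤ (n : ℝ) ^ (1 - b) := hK n hKn
  have hP : (0 : ℝ) < (q : ℝ) ^ (d - 1) := pow_pos hq0 _
  have h1 : (q : ℝ) ^ (d - 1) ≤ (n : ℝ) ^ (b * n) := by
    calc (q : ℝ) ^ (d - 1) ≤ (n : ℝ) ^ (d - 1) := by gcongr
      _ ≤ (n : ℝ) ^ d := pow_le_pow_right₀ hn1 (Nat.sub_le _ _)
      _ = (n : ℝ) ^ (d : ℝ) := (Real.rpow_natCast _ _).symm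
      _ ≤ _ := Real.rpow_le_rpow_of_exponent_le hn1 hdn
  have h2 : (12 : ℝ) ^ n * (q : ℝ) ^ (d - 1) ≤ (n : ℝ) ^ n := by
    calc (12 : ℝ) ^ n * (q : ℝ) ^ (d - 1)
        ≤ ((n : ℝ) ^ (1 - b)) ^ n * (n : ℝ) ^ (b * n) := by gcongr
      _ = (n : ℝ) ^ n := by
        rw [← Real.rpow_mul_natCast hn0.le, ← Real.rpow_add hn0, ← Real.rpow_natCast]
        congr 1; ring
  have h3 : (n : ℝ) ^ n ≤ 3 ^ n * (n ! : ℝ) := by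
    have h := Real.pow_div_factorial_le_exp (n : ℝ) hn0.le n
    rw [div_le_iff₀ (by positivity)] at h
    refine h.trans ?_
    have : Real.exp n ≤ 3 ^ n := by
      rw [← Real.exp_one_pow]
      exact pow_le_pow_left₀ (Real.exp_pos _).le
        (Real.exp_one_lt_d9.le.trans (by norm_num)) _
    gcongr
  have h4 : (4 : ℝ) ^ n * (q : ℝ) ^ (d - 1) ≤ (n ! : ℝ) := by
    have e : (12 : ℝ) ^ n = 3 ^ n * 4 ^ n := by rw [← mul_pow]; norm_num
    rw [e, mul_assoc] at h2
    exact le_of_mul_le_mul_left (h2.trans h3) (by positivity)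
  have h5 : (2 : ℝ) ^ (n - q - 1) ≤ 2 ^ n :=
    pow_le_pow_right₀ (by norm_num) (by omega)
  have h6 : M < (2 : ℝ) ^ n := hMn.trans_lt (by exact_mod_cast Nat.lt_two_pow_self)
  rw [lt_div_iff₀ (by positivity)]
  calc M * (2 ^ (n - q - 1) * (q : ℝ) ^ (d - 1))
      < 2 ^ n * (2 ^ (n - q - 1) * (q : ℝ) ^ (d - 1)) := by gcongr
    _ ≤ 2 ^ n * (2 ^ n * (q : ℝ) ^ (d - 1)) := by gcongr
    _ = 4 ^ n * (q : ℝ) ^ (d - 1) := by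
      rw [← mul_assoc, ← mul_pow]; norm_num
    _ ≤ _ := h4
end
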